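/- arXiv:2507.14033 — 2 statements merged into one kernel-verified Lean document; each statement's English description precedes it below -/
import Mathlib

section
/- Let x ∈ D be a dominant element. Then the upper set of x in the Bruhat order is described geometrically by the star of x: for every z ∈ W, x ≤ z if and only if cen(z) ∉ St°(x). Equivalently, {z ∈ W : x ≤ z} = {z ∈ W : cen(z) does not lie in the interior of St(x)}. -/
noncomputable section

open scoped RealInnerProductSpace

/-- The Bruhat strict order on a Coxeter group: the transitive closure of the relation
"multiply on the left by a reflection, increasing the length". -/
def bruhatLT {B : Type*} {W : Type*} [Group W] {M : CoxeterMatrix B}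
    (cs : CoxeterSystem M W) : W → W → Prop :=
  Relation.TransGen (fun a b => (∃ t, cs.IsReflection t ∧ b = t * a) ∧ cs.length a < cs.length b)

/-- The Bruhat order on a Coxeter group. -/
def bruhatLE {B : Type*} {W : Type*} [Group W] {M : CoxeterMatrix B}
    (cs : CoxeterSystem M W) (x y : W) : Prop :=
  x = y ∨ bruhatLT cs x y

/-- The Bruhat interval `[x, y]` as a set. -/
def Iset {B : Type*} {W : Type*} [Group W] {M : CoxeterMatrix B}
    (cs : CoxeterSystem M W) (x y : W) : Set W :=
  {z | bruhatLE cs x z ∧ bruhatLE cs z y}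

/-- The Bruhat covers `U(x)` of an element `x`. -/
def Uset {B : Type*} {W : Type*} [Group W] {M : CoxeterMatrix B}
    (cs : CoxeterSystem M W) (x : W) : Set W :=
  {w | bruhatLT cs x w ∧ cs.length w = cs.length x + 1}

/-- The Bruhat cocovers `L(y)` of an element `y`. -/
def Lset {B : Type*} {W : Type*} [Group W] {M : CoxeterMatrix B}
    (cs : CoxeterSystem M W) (y : W) : Set W :=
  {w | bruhatLT cs w y ∧ cs.length y = cs.length w + 1}

/-- An interval `[x, y]` is full if it contains all Bruhat covers of `x` and all
Bruhat cocovers of `y`. -/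
def FullInt {B : Type*} {W : Type*} [Group W] {M : CoxeterMatrix B}
    (cs : CoxeterSystem M W) (x y : W) : Prop :=
  Uset cs x ⊆ Iset cs x y ∧ Lset cs y ⊆ Iset cs x y

/-- Two Bruhat intervals (possibly in different Coxeter groups) are isomorphic as posets. -/
def IntervalIso {B : Type*} {W : Type*} {B' : Type*} {W' : Type*} [Group W] [Group W']
    {M : CoxeterMatrix B} {M' : CoxeterMatrix B'}
    (cs : CoxeterSystem M W) (cs' : CoxeterSystem M' W') (x y : W) (x' y' : W') : Prop :=
  ∃ f : {z : W // bruhatLE cs x z ∧ bruhatLE cs z y} ≃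
        {z : W' // bruhatLE cs' x' z ∧ bruhatLE cs' z y'},
    ∀ u v, bruhatLE cs u.1 v.1 ↔ bruhatLE cs' (f u).1 (f v).1

/-- The group `G` of generic automorphisms: the subgroup of the permutation group of `W`
generated by the Dynkin diagram automorphisms `δ`, `σ` and inversion. -/
def Gsub {W : Type*} [Group W] (dl sg : W ≃* W) : Subgroup (Equiv.Perm W) :=
  Subgroup.closure {dl.toEquiv, sg.toEquiv, Equiv.inv W}

/-- The Euclidean plane, with coordinates taken in the basis of simple roots of `A₂`. -/
abbrev E2 : Type := ℝ × ℝ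

/-- The `A₂` inner product on the plane, in which `(αᵢ, αᵢ) = 2` and `(α₁, α₂) = -1`. -/
def B2 (u v : E2) : ℝ := 2*u.1*v.1 - u.1*v.2 - u.2*v.1 + 2*u.2*v.2

/-- The simple root `α₁`. -/
def a1 : E2 := (1, 0)
/-- The simple root `α₂`. -/
def a2 : E2 := (0, 1)
/-- The fundamental weight `ϖ₁`, satisfying `(αᵢ, ϖⱼ) = δᵢⱼ`. -/
def fw1 : E2 := (2/3, 1/3)
/-- The fundamental weight `ϖ₂`. -/
def fw2 : E2 := (1/3, 2/3)
/-- `ρ = ϖ₁ + ϖ₂ = α₁ + α₂`. -/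
def rho2 : E2 := (1, 1)

/-- The affine reflection `s_{α,k}` of the plane in the line `{v | (α, v) = k}`,
for a root `α` with `(α, α) = 2`. -/
def reflE (a : E2) (k : ℝ) (v : E2) : E2 := v - (B2 a v - k) • a

/-- The barycenter of the alcove of `z`, i.e. the image under the affine action of `z` of
the barycenter `-ρ/3` of the fundamental alcove (whose vertices are `0, -ϖ₁, -ϖ₂`). -/
def cen {W : Type*} [Group W] (act : W →* Equiv.Perm E2) (z : W) : E2 :=
  act z ((-(1/3 : ℝ)) • rho2)

/-- The weight lattice `Λ = ℤϖ₁ ⊕ ℤϖ₂`. -/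
def wLat : Set E2 := {v | ∃ a b : ℤ, v = (a : ℝ) • fw1 + (b : ℝ) • fw2}

/-- The fundamental alcove `A₊`. -/
def AlcoveFund : Set E2 :=
  {v | (-1 < B2 a1 v ∧ B2 a1 v < 0) ∧ (-1 < B2 a2 v ∧ B2 a2 v < 0) ∧
    (-1 < B2 rho2 v ∧ B2 rho2 v < 0)}

/-- The zone `F_id` of the plane. -/
def Fid : Set E2 := {v | -1 ≤ B2 a1 v ∧ -1 ≤ B2 a2 v ∧ -1 ≤ B2 rho2 v}

/-- The cone `K` of nonnegative combinations of the simple roots. -/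
def coneK : Set E2 := {v | ∃ a b : ℝ, 0 ≤ a ∧ 0 ≤ b ∧ v = a • a1 + b • a2}

/-- The set `D` of dominant elements, given functions `θ, θˢ` enumerating them. -/
def Dset {W : Type*} (th ths : ℕ → ℕ → W) : Set W :=
  {w | (∃ m n, w = th m n) ∨ (∃ m n, w = ths m n)}

/-- The polygon `Pgn_{x,y} = F_id ∩ (cen x + K) ∩ (cen y - K)`. -/
def Pgn {W : Type*} [Group W] (act : W →* Equiv.Perm E2) (x y : W) : Set E2 :=
  {v ∈ Fid | (∃ k ∈ coneK, v = cen act x + k) ∧ (∃ k ∈ coneK, v = cen act y - k)}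

/-- The element `x_k`: the product of the first `k` terms of `s₁, s₂, s₀, s₁, s₂, s₀, …`. -/
def xelt {W : Type*} [Group W] {M : CoxeterMatrix (Fin 3)} (cs : CoxeterSystem M W)
    (k : ℕ) : W :=
  ((List.range k).map (fun j => cs.simple (⟨(j + 1) % 3, Nat.mod_lt _ (by norm_num)⟩ : Fin 3))).prod

/-- `zoneOf cs w v` says that `w` is one of the six elements of `W_f` and `v` lies in the
corresponding zone `F_w` of the plane. -/
def zoneOf {W : Type*} [Group W] {M : CoxeterMatrix (Fin 3)} (cs : CoxeterSystem M W)
    (w : W) (v : E2) : Prop :=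
  (w = 1 ∧ v ∈ Fid) ∨
  (w = cs.simple 1 ∧ B2 a1 v ≤ -1 ∧ -1 ≤ B2 rho2 v) ∨
  (w = cs.simple 2 ∧ B2 a2 v ≤ -1 ∧ -1 ≤ B2 rho2 v) ∨
  (w = cs.simple 1 * cs.simple 2 ∧ B2 rho2 v ≤ -1 ∧ 0 ≤ B2 a2 v) ∨
  (w = cs.simple 2 * cs.simple 1 ∧ B2 rho2 v ≤ -1 ∧ 0 ≤ B2 a1 v) ∨
  (w = cs.simple 1 * cs.simple 2 * cs.simple 1 ∧ B2 a1 v ≤ 0 ∧ B2 a2 v ≤ 0)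

/-- Thickness of the interval `[x,y]`: `x + 2αᵢ` and `y - 2αᵢ` belong to `[x,y]` and their
barycenters lie in `F_id`, for `i = 1, 2`. -/
def Thick {W : Type*} [Group W] {M : CoxeterMatrix (Fin 3)} (cs : CoxeterSystem M W)
    (act : W →* Equiv.Perm E2) (Wadd : W → E2 → W) (x y : W) : Prop :=
  Wadd x ((2 : ℝ) • a1) ∈ Iset cs x y ∧ Wadd x ((2 : ℝ) • a2) ∈ Iset cs x y ∧
  Wadd y (-((2 : ℝ) • a1)) ∈ Iset cs x y ∧ Wadd y (-((2 : ℝ) • a2)) ∈ Iset cs x y ∧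
  cen act (Wadd x ((2 : ℝ) • a1)) ∈ Fid ∧ cen act (Wadd x ((2 : ℝ) • a2)) ∈ Fid ∧
  cen act (Wadd y (-((2 : ℝ) • a1))) ∈ Fid ∧ cen act (Wadd y (-((2 : ℝ) • a2))) ∈ Fid

/-- The positive roots, indexed so that the simple reflection `sᵢ` is in a line orthogonal to
`posRoot i`. -/
def posRoot : Fin 3 → E2 := ![rho2, a1, a2]

/-- The level of the line fixed by the simple reflection `sᵢ`. -/
def simpleLevel : Fin 3 → ℤ := ![-1, 0, 0]

/-- The affine function vanishing on the line `{v | (posRoot i, v) = k}`. -/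
def wallFun (i : Fin 3) (k : ℤ) (v : E2) : ℝ := B2 (posRoot i) v - k

/-- The reflection in the line `{v | (posRoot i, v) = k}`. -/
def wallRefl (i : Fin 3) (k : ℤ) (v : E2) : E2 := reflE (posRoot i) k v

/-- The barycenter of the fundamental alcove. -/
def baseCen : E2 := (-(1/3 : ℝ)) • rho2

/-- The point `v` with `3 (α₁, v) = X` and `3 (α₂, v) = Y`. -/
def latPt (X Y : ℤ) : E2 := ((2 * X + Y) / 9, (X + 2 * Y) / 9)

/-- The value at `latPt X Y` of three times the root `posRoot i`. -/
def latVal (i : Fin 3) (X Y : ℤ) : ℤ := ![X + Y, X, Y] i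

/-- The first coordinate of the reflection of `latPt X Y`. -/
def reflX (i : Fin 3) (k X Y : ℤ) : ℤ := ![-Y + 3 * k, -X + 6 * k, X + Y - 3 * k] i

/-- The second coordinate of the reflection of `latPt X Y`. -/
def reflY (i : Fin 3) (k X Y : ℤ) : ℤ := ![-X + 3 * k, X + Y - 3 * k, -Y + 6 * k] i

/-- The point `latPt X Y` lies in the interior of the star of `latPt X₀ Y₀`. -/
def InStar (X₀ Y₀ X Y : ℤ) : Prop :=
  (X + 2 * Y < X₀ + 2 * Y₀ ∧ -(X₀ + 2 * Y₀) - 9 < 2 * X + Y ∧ -(X₀ + 2 * Y₀) - 9 < Y - X) ∨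
  (2 * X + Y < 2 * X₀ + Y₀ ∧ -(2 * X₀ + Y₀) - 9 < X + 2 * Y ∧ Y - X < 2 * X₀ + Y₀ + 9)

/-- The line of level `k` orthogonal to `posRoot i` separates `latPt X Y` from the fundamental
alcove. -/
def Separates (i : Fin 3) (k X Y : ℤ) : Prop :=
  (0 ≤ k ∧ 3 * k < latVal i X Y) ∨ (k < 0 ∧ latVal i X Y < 3 * k)

lemma baseCen_eq : baseCen = latPt (-1) (-1) := by
  simp only [baseCen, latPt, rho2, Prod.smul_mk, smul_eq_mul]
  norm_num

lemma wallFun_latPt (i : Fin 3) (k X Y : ℤ) :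
    wallFun i k (latPt X Y) = ((latVal i X Y - 3 * k : ℤ) : ℝ) / 3 := by
  fin_cases i <;> simp [wallFun, latPt, latVal, posRoot, B2, rho2, a1, a2] <;> ring

lemma wallRefl_latPt (i : Fin 3) (k X Y : ℤ) :
    wallRefl i k (latPt X Y) = latPt (reflX i k X Y) (reflY i k X Y) := by
  fin_cases i <;> ext <;>
    simp [wallRefl, reflE, latPt, reflX, reflY, posRoot, B2, rho2, a1, a2] <;> ring

lemma wallFun_wallRefl (i : Fin 3) (k : ℤ) (v : E2) :
    wallFun i k (wallRefl i k v) = -wallFun i k v := by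
  fin_cases i <;> simp [wallFun, wallRefl, reflE, posRoot, B2, rho2, a1, a2] <;> ring

lemma wallRefl_wallRefl (i : Fin 3) (k : ℤ) (v : E2) :
    wallRefl i k (wallRefl i k v) = v := by
  fin_cases i <;> ext <;> simp [wallRefl, reflE, posRoot, B2, rho2, a1, a2] <;> ring

lemma wallRefl_conj_same (i : Fin 3) (k l : ℤ) (v : E2) :
    wallRefl i k (wallRefl i l (wallRefl i k v)) = wallRefl i (2 * k - l) v := by
  fin_cases i <;> ext <;> simp [wallRefl, reflE, posRoot, B2, rho2, a1, a2] <;> ring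

/-- The line `(i, k)` separates `v` from the fundamental alcove exactly when the sign of
`wallFun` changes. -/
lemma wallFun_mul_neg_iff (i : Fin 3) (k X Y : ℤ) :
    wallFun i k baseCen * wallFun i k (latPt X Y) < 0 ↔ Separates i k X Y := by
  rw [baseCen_eq, wallFun_latPt, wallFun_latPt]
  have key : ((latVal i (-1) (-1) - 3 * k : ℤ) : ℝ) / 3 * (((latVal i X Y - 3 * k : ℤ) : ℝ) / 3) < 0
      ↔ (latVal i (-1) (-1) - 3 * k) * (latVal i X Y - 3 * k) < 0 := by
    rw [← Int.cast_lt_zero (R := ℝ)]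
    push_cast
    constructor <;> intro h <;> linarith
  rw [key, mul_neg_iff, Separates]
  have : latVal i (-1) (-1) = -1 ∨ latVal i (-1) (-1) = -2 := by
    fin_cases i <;> simp [latVal]
  omega

/-- A line separating the fundamental alcove from its image under a simple reflection is the
line of that reflection. -/
lemma eq_simple_of_separates {i j : Fin 3} {k : ℤ}
    (h : wallFun i k baseCen * wallFun i k (wallRefl j (simpleLevel j) baseCen) < 0) :
    i = j ∧ k = simpleLevel j := by
  nth_rw 2 [baseCen_eq] at h
  rw [wallRefl_latPt, wallFun_mul_neg_iff] at h
  fin_cases i <;> fin_cases j <;>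
    simp [Separates, latVal, reflX, reflY, simpleLevel] at h ⊢ <;> omega

/-- Simple reflections permute the lines `(i, k)`. -/
lemma exists_simple_conj (j i : Fin 3) (k : ℤ) : ∃ (i' : Fin 3) (k' : ℤ) (ε : ℝ), ε * ε = 1 ∧
    (∀ v, wallFun i k (wallRefl j (simpleLevel j) v) = ε * wallFun i' k' v) ∧
    ∀ v, wallRefl i k (wallRefl j (simpleLevel j) v) =
      wallRefl j (simpleLevel j) (wallRefl i' k' v) := by
  fin_cases j <;> fin_cases i
  · refine ⟨0, -2 - k, -1, by norm_num, fun v => ?_, fun v => Prod.ext ?_ ?_⟩ <;>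
      simp [wallFun, wallRefl, reflE, posRoot, B2, rho2, a1, a2, simpleLevel] <;> ring
  · refine ⟨2, -1 - k, -1, by norm_num, fun v => ?_, fun v => Prod.ext ?_ ?_⟩ <;>
      simp [wallFun, wallRefl, reflE, posRoot, B2, rho2, a1, a2, simpleLevel] <;> ring
  · refine ⟨1, -1 - k, -1, by norm_num, fun v => ?_, fun v => Prod.ext ?_ ?_⟩ <;>
      simp [wallFun, wallRefl, reflE, posRoot, B2, rho2, a1, a2, simpleLevel] <;> ring
  · refine ⟨2, k, 1, by norm_num, fun v => ?_, fun v => Prod.ext ?_ ?_⟩ <;>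
      simp [wallFun, wallRefl, reflE, posRoot, B2, rho2, a1, a2, simpleLevel] <;> ring
  · refine ⟨1, -k, -1, by norm_num, fun v => ?_, fun v => Prod.ext ?_ ?_⟩ <;>
      simp [wallFun, wallRefl, reflE, posRoot, B2, rho2, a1, a2, simpleLevel] <;> ring
  · refine ⟨0, k, 1, by norm_num, fun v => ?_, fun v => Prod.ext ?_ ?_⟩ <;>
      simp [wallFun, wallRefl, reflE, posRoot, B2, rho2, a1, a2, simpleLevel] <;> ring
  · refine ⟨1, k, 1, by norm_num, fun v => ?_, fun v => Prod.ext ?_ ?_⟩ <;>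
      simp [wallFun, wallRefl, reflE, posRoot, B2, rho2, a1, a2, simpleLevel] <;> ring
  · refine ⟨0, k, 1, by norm_num, fun v => ?_, fun v => Prod.ext ?_ ?_⟩ <;>
      simp [wallFun, wallRefl, reflE, posRoot, B2, rho2, a1, a2, simpleLevel] <;> ring
  · refine ⟨2, -k, -1, by norm_num, fun v => ?_, fun v => Prod.ext ?_ ?_⟩ <;>
      simp [wallFun, wallRefl, reflE, posRoot, B2, rho2, a1, a2, simpleLevel] <;> ring

lemma inStar_of_separates {X₀ Y₀ : ℤ} {i : Fin 3} {k X Y : ℤ} (hs : Separates i k X Y)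
    (h : InStar X₀ Y₀ X Y) : InStar X₀ Y₀ (reflX i k X Y) (reflY i k X Y) := by
  fin_cases i <;> simp [Separates, InStar, latVal, reflX, reflY] at hs h ⊢ <;> omega

/-- From a point outside the star one can descend by a reflection without entering the star. -/
lemma exists_separates_not_inStar {X₀ Y₀ X Y : ℤ} (hX₀ : 0 < X₀) (hY₀ : 0 < Y₀)
    (h₀ : (3 : ℤ) ∣ X₀ - Y₀) (hX₀3 : ¬ (3 : ℤ) ∣ X₀)
    (h : (3 : ℤ) ∣ X - Y) (hX3 : ¬ (3 : ℤ) ∣ X)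
    (hne : ¬ (X = X₀ ∧ Y = Y₀)) (hout : ¬ InStar X₀ Y₀ X Y) :
    ∃ i k, Separates i k X Y ∧ ¬ InStar X₀ Y₀ (reflX i k X Y) (reflY i k X Y) := by
  by_contra hcon
  push Not at hcon
  have H0 (k : ℤ) := hcon 0 k
  have H1 (k : ℤ) := hcon 1 k
  have H2 (k : ℤ) := hcon 2 k
  simp [Separates, InStar, latVal, reflX, reflY] at H0 H1 H2 hout
  clear hcon
  have hA : X₀ + 2 * Y₀ ≤ X + 2 * Y ∨ 2 * X + Y ≤ -(X₀ + 2 * Y₀) - 9 ∨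
      Y - X ≤ -(X₀ + 2 * Y₀) - 9 := by omega
  have hB : 2 * X₀ + Y₀ ≤ 2 * X + Y ∨ X + 2 * Y ≤ -(2 * X₀ + Y₀) - 9 ∨
      2 * X₀ + Y₀ + 9 ≤ Y - X := by omega
  clear hout
  have H00 := H0 0
  have H01 := H0 (-1)
  have H10 := H1 0
  have H11 := H1 (-1)
  have H20 := H2 0
  have H21 := H2 (-1)
  rcases hA with hA | hA | hA <;> rcases hB with hB | hB | hB
  · clear H00 H01 H10 H11 H20 H21
    obtain ⟨m, r, rfl, hr⟩ : ∃ m r, X = 3 * m + r ∧ (r = 1 ∨ r = 2) :=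
      ⟨X / 3, X % 3, by omega, by omega⟩
    obtain ⟨n, rfl⟩ : ∃ n, Y = 3 * n + r := ⟨(Y - r) / 3, by omega⟩
    obtain ⟨u, s, rfl, hs⟩ : ∃ u s, X₀ = 3 * u + s ∧ (s = 1 ∨ s = 2) :=
      ⟨X₀ / 3, X₀ % 3, by omega, by omega⟩
    obtain ⟨w, rfl⟩ : ∃ w, Y₀ = 3 * w + s := ⟨(Y₀ - s) / 3, by omega⟩
    have P1 := H1 m
    have N1 := H1 (m + 1)
    have P2 := H2 n
    have N2 := H2 (n + 1)
    have P0 := H0 (m + n + r - 1)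
    clear H0 H1 H2 h₀ h hX₀3 hX3
    have hXn : -1 ≤ m := by clear P1 P2 N2 P0; omega
    have hYn : -1 ≤ n := by clear P2 P1 N1 P0; omega
    clear N1 N2
    rcases hr with rfl | rfl <;> rcases hs with rfl | rfl <;> omega
  all_goals omega

/-- The interior of the star, in coordinates. -/
lemma mem_interior_star_iff {p q : ℝ} (hp : 0 < p) (hq : 0 < q) (v : E2) :
    v ∈ interior
        (({v : E2 | B2 fw2 v ≤ q ∧ -q - 1 ≤ B2 fw1 v ∧ -q - 1 ≤ B2 (fw2 - fw1) v} : Set E2) ∪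
         {v : E2 | B2 fw1 v ≤ p ∧ -p - 1 ≤ B2 fw2 v ∧ B2 (fw2 - fw1) v ≤ p + 1}) ↔
      (v.2 < q ∧ -q - 1 < v.1 ∧ -q - 1 < v.2 - v.1) ∨
      (v.1 < p ∧ -p - 1 < v.2 ∧ v.2 - v.1 < p + 1) := by
  have e1 (w : E2) : B2 fw1 w = w.1 := by simp only [B2, fw1]; ring
  have e2 (w : E2) : B2 fw2 w = w.2 := by simp only [B2, fw2]; ring
  have e3 (w : E2) : B2 (fw2 - fw1) w = w.2 - w.1 := by
    simp only [B2, fw1, fw2, Prod.mk_sub_mk]; ring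
  simp only [e1, e2, e3]
  constructor
  · intro hv
    obtain ⟨ε, hε, hball⟩ := Metric.mem_nhds_iff.1 (mem_interior_iff_mem_nhds.1 hv)
    have hmem (a b : ℝ) (ha : |a| < ε) (hb : |b| < ε) := hball (show (v.1 + a, v.2 + b) ∈ _ by
      rw [Metric.mem_ball, Prod.dist_eq, max_lt_iff]
      simpa [Real.dist_eq] using ⟨ha, hb⟩)
    have hε2 : |ε / 2| < ε := by rw [abs_of_pos (by linarith)]; linarith
    have hε2' : |-(ε / 2)| < ε := by rwa [abs_neg]
    have m1 := hmem _ _ hε2 hε2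
    have m2 := hmem _ _ hε2 hε2'
    have m3 := hmem _ _ hε2' hε2
    have m4 := hmem _ _ hε2' hε2'
    simp only [Set.mem_union, Set.mem_ofPred_eq] at m1 m2 m3 m4
    by_contra hcon
    push Not at hcon
    grind
  · have c1 : Continuous fun w : E2 => w.1 := continuous_fst
    have c2 : Continuous fun w : E2 => w.2 := continuous_snd
    have c3 : Continuous fun w : E2 => w.2 - w.1 := c2.sub c1
    rintro (⟨u1, u2, u3⟩ | ⟨u1, u2, u3⟩) <;> rw [mem_interior_iff_mem_nhds]
    · filter_upwards [c2.continuousAt.eventually_lt continuousAt_const u1,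
        continuousAt_const.eventually_lt c1.continuousAt u2,
        continuousAt_const.eventually_lt c3.continuousAt u3] with w w1 w2 w3
      exact Or.inl ⟨w1.le, w2.le, w3.le⟩
    · filter_upwards [c1.continuousAt.eventually_lt continuousAt_const u1,
        continuousAt_const.eventually_lt c2.continuousAt u2,
        c3.continuousAt.eventually_lt continuousAt_const u3] with w w1 w2 w3
      exact Or.inr ⟨w1.le, w2.le, w3.le⟩

section AffineAction

variable {W : Type*} [Group W] {M : CoxeterMatrix (Fin 3)} {cs : CoxeterSystem M W}
  {act : W →* Equiv.Perm E2}

/-- Every group element permutes the lines `(i, k)`. -/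
lemma exists_conj (hact : ∀ j v, act (cs.simple j) v = wallRefl j (simpleLevel j) v) (w : W) :
    ∀ (i : Fin 3) (k : ℤ), ∃ (i' : Fin 3) (k' : ℤ) (ε : ℝ), ε * ε = 1 ∧
      (∀ v, wallFun i k (act w v) = ε * wallFun i' k' v) ∧
      ∀ v, wallRefl i k (act w v) = act w (wallRefl i' k' v) := by
  induction w using cs.simple_induction with
  | simple j =>
    intro i k
    simpa only [hact] using exists_simple_conj j i k
  | one => exact fun i k => ⟨i, k, 1, by norm_num, by simp, by simp⟩
  | mul w₁ w₂ ih₁ ih₂ =>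
    intro i k
    obtain ⟨i₁, k₁, ε₁, hε₁, hf₁, hr₁⟩ := ih₁ i k
    obtain ⟨i₂, k₂, ε₂, hε₂, hf₂, hr₂⟩ := ih₂ i₁ k₁
    refine ⟨i₂, k₂, ε₁ * ε₂, by linear_combination ε₂ * ε₂ * hε₁ + hε₂, fun v => ?_, fun v => ?_⟩
    · rw [map_mul, Equiv.Perm.mul_apply, hf₁, hf₂]; ring
    · rw [map_mul, Equiv.Perm.mul_apply, hr₁, hr₂, Equiv.Perm.mul_apply]

/-- Reflections of the group act as reflections in lines `(i, k)`. -/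
lemma exists_wallRefl_of_isReflection
    (hact : ∀ j v, act (cs.simple j) v = wallRefl j (simpleLevel j) v) {t : W}
    (ht : cs.IsReflection t) : ∃ i k, ∀ v, act t v = wallRefl i k v := by
  obtain ⟨w, j, rfl⟩ := ht
  obtain ⟨i, k, -, -, -, hr⟩ := exists_conj hact w⁻¹ j (simpleLevel j)
  refine ⟨i, k, fun v => ?_⟩
  rw [map_mul, map_mul, Equiv.Perm.mul_apply, Equiv.Perm.mul_apply, hact, hr, map_inv]
  simp

/-- Every reflection in a line `(i, k)` comes from a reflection of the group. -/
lemma exists_isReflection_wallRefl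
    (hact : ∀ j v, act (cs.simple j) v = wallRefl j (simpleLevel j) v) (i : Fin 3) (k : ℤ) :
    ∃ t, cs.IsReflection t ∧ ∀ v, act t v = wallRefl i k v := by
  have hconj {t u : W} {i j : Fin 3} {k l : ℤ} (hu : cs.IsReflection u)
      (ht' : ∀ v, act t v = wallRefl j l v) (ht : cs.IsReflection t)
      (hu' : ∀ v, act u v = wallRefl i k v) : cs.IsReflection (t * u * t⁻¹) ∧
      ∀ v, act (t * u * t⁻¹) v = wallRefl j l (wallRefl i k (wallRefl j l v)) := by
    refine ⟨hu.conj t, fun v => ?_⟩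
    rw [ht.inv, map_mul, map_mul, Equiv.Perm.mul_apply, Equiv.Perm.mul_apply, ht', hu', ht']
  have hsimple (j : Fin 3) := cs.isReflection_simple j
  have base : (∃ t, cs.IsReflection t ∧ ∀ v, act t v = wallRefl i 0 v) ∧
      ∃ t, cs.IsReflection t ∧ ∀ v, act t v = wallRefl i (-1) v := by
    have conj_eq (j i i' : Fin 3) (k k' : ℤ)
        (h : ∀ v, wallRefl j (simpleLevel j) (wallRefl i k (wallRefl j (simpleLevel j) v)) =
          wallRefl i' k' v) (hi : ∃ t, cs.IsReflection t ∧ ∀ v, act t v = wallRefl i k v) :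
        ∃ t, cs.IsReflection t ∧ ∀ v, act t v = wallRefl i' k' v := by
      obtain ⟨t, ht, ht'⟩ := hi
      obtain ⟨h₁, h₂⟩ := hconj ht (hact j) (hsimple j) ht'
      exact ⟨_, h₁, fun v => (h₂ v).trans (h v)⟩
    have hs (j : Fin 3) : ∃ t, cs.IsReflection t ∧ ∀ v, act t v = wallRefl j (simpleLevel j) v :=
      ⟨_, hsimple j, hact j⟩
    fin_cases i
    · refine ⟨conj_eq 1 2 _ _ _ (fun v => Prod.ext ?_ ?_) (hs 2), hs 0⟩ <;>
        simp [wallRefl, reflE, posRoot, B2, rho2, a1, a2, simpleLevel] <;> ring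
    · refine ⟨hs 1, conj_eq 2 0 _ _ _ (fun v => Prod.ext ?_ ?_) (hs 0)⟩ <;>
        simp [wallRefl, reflE, posRoot, B2, rho2, a1, a2, simpleLevel] <;> ring
    · refine ⟨hs 2, conj_eq 1 0 _ _ _ (fun v => Prod.ext ?_ ?_) (hs 0)⟩ <;>
        simp [wallRefl, reflE, posRoot, B2, rho2, a1, a2, simpleLevel] <;> ring
  have step (k l : ℤ) (hk : ∃ t, cs.IsReflection t ∧ ∀ v, act t v = wallRefl i k v)
      (hl : ∃ t, cs.IsReflection t ∧ ∀ v, act t v = wallRefl i l v) :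
      ∃ t, cs.IsReflection t ∧ ∀ v, act t v = wallRefl i (2 * k - l) v := by
    obtain ⟨t, ht, ht'⟩ := hk
    obtain ⟨u, hu, hu'⟩ := hl
    obtain ⟨h₁, h₂⟩ := hconj hu ht' ht hu'
    exact ⟨_, h₁, fun v => (h₂ v).trans (wallRefl_conj_same i k l v)⟩
  have both : (∃ t, cs.IsReflection t ∧ ∀ v, act t v = wallRefl i k v) ∧
      ∃ t, cs.IsReflection t ∧ ∀ v, act t v = wallRefl i (k - 1) v := by
    induction k using Int.induction_on with
    | zero => simpa using base
    | succ n ih =>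
      refine ⟨?_, by simpa using ih.1⟩
      have := step _ _ ih.1 ih.2
      rwa [show 2 * (n : ℤ) - (n - 1) = n + 1 by ring] at this
    | pred n ih =>
      refine ⟨ih.2, ?_⟩
      have := step _ _ ih.2 ih.1
      rwa [show 2 * (-(n : ℤ) - 1) - -n = -n - 1 - 1 by ring] at this
  exact both.1

/-- Barycenters of alcoves are the points `latPt X Y` with `X ≡ Y ≢ 0` modulo `3`. -/
lemma exists_cen_eq_latPt
    (hact : ∀ j v, act (cs.simple j) v = wallRefl j (simpleLevel j) v) (z : W) :
    ∃ X Y : ℤ, cen act z = latPt X Y ∧ (3 : ℤ) ∣ X - Y ∧ ¬ (3 : ℤ) ∣ X := by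
  induction z using cs.simple_induction_left with
  | one =>
    exact ⟨-1, -1, by simpa [cen, baseCen] using baseCen_eq, by norm_num, by norm_num⟩
  | mul_simple_left w j ih =>
    obtain ⟨X, Y, hc, h1, h2⟩ := ih
    refine ⟨reflX j (simpleLevel j) X Y, reflY j (simpleLevel j) X Y, ?_, ?_⟩
    · rw [← wallRefl_latPt, ← hc, ← hact, cen, cen, map_mul, Equiv.Perm.mul_apply]
    · fin_cases j <;> simp [reflX, reflY, simpleLevel] <;> omega

lemma wallFun_cen_ne_zero
    (hact : ∀ j v, act (cs.simple j) v = wallRefl j (simpleLevel j) v) (i : Fin 3) (k : ℤ)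
    (z : W) : wallFun i k (cen act z) ≠ 0 := by
  obtain ⟨X, Y, hc, h1, h2⟩ := exists_cen_eq_latPt hact z
  rw [hc, wallFun_latPt]
  have : latVal i X Y - 3 * k ≠ 0 := by
    fin_cases i <;> simp [latVal] <;> omega
  positivity

/-- Reflecting in a line which separates an alcove from the fundamental one decreases the
length. -/
lemma length_mul_lt_of_separates (hcen : Function.Injective (cen act))
    (hact : ∀ j v, act (cs.simple j) v = wallRefl j (simpleLevel j) v) {t : W} {i : Fin 3}
    {k : ℤ} (ht : ∀ v, act t v = wallRefl i k v) {a : W}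
    (ha : wallFun i k baseCen * wallFun i k (cen act a) < 0) :
    cs.length (t * a) < cs.length a := by
  induction hn : cs.length a generalizing a with
  | zero =>
    rw [cs.length_eq_zero_iff] at hn
    rw [hn, show cen act 1 = baseCen by simp [cen, baseCen]] at ha
    exact absurd ha (mul_self_nonneg _).not_gt
  | succ n ih =>
    have hne : a ≠ 1 := by
      rintro rfl
      simp at hn
    obtain ⟨j, hj⟩ := cs.exists_rightDescent_of_ne_one hne
    obtain ⟨b, rfl⟩ : ∃ b, a = b * cs.simple j := ⟨a * cs.simple j, by simp⟩
    rw [CoxeterSystem.IsRightDescent, cs.simple_mul_simple_cancel_right] at hj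
    have hb : cs.length b = n := by
      have := cs.length_mul_simple b j
      omega
    by_cases hsep : wallFun i k baseCen * wallFun i k (cen act b) < 0
    · have h₁ := ih hsep hb
      have h₂ := cs.length_mul_le (t * b) (cs.simple j)
      rw [cs.length_simple] at h₂
      rw [← mul_assoc]
      omega
    · have hcross : wallFun i k (cen act b) * wallFun i k (cen act (b * cs.simple j)) < 0 := by
        have h₁ := wallFun_cen_ne_zero hact i k b
        have h₂ : wallFun i k baseCen ≠ 0 := by
          simpa [cen, baseCen] using wallFun_cen_ne_zero hact i k 1
        have h₃ : 0 < wallFun i k baseCen * wallFun i k (cen act b) :=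
          lt_of_le_of_ne (not_lt.1 hsep) (mul_ne_zero h₂ h₁).symm
        rcases mul_pos_iff.1 h₃ with ⟨p, q⟩ | ⟨p, q⟩
        · exact mul_neg_of_pos_of_neg q (by nlinarith)
        · exact mul_neg_of_neg_of_pos q (by nlinarith)
      obtain ⟨i', k', ε, hε, hf, hr⟩ := exists_conj hact b i k
      have hcb : cen act (b * cs.simple j) = act b (wallRefl j (simpleLevel j) baseCen) := by
        rw [cen, map_mul, Equiv.Perm.mul_apply, hact, baseCen]
      rw [hcb, show cen act b = act b baseCen from rfl, hf, hf, mul_mul_mul_comm, hε,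
        one_mul] at hcross
      obtain ⟨rfl, rfl⟩ := eq_simple_of_separates hcross
      have : t * (b * cs.simple i') = b := by
        apply hcen
        rw [cen, map_mul, Equiv.Perm.mul_apply, ht]
        change wallRefl i k (cen act (b * cs.simple i')) = _
        rw [hcb, hr, wallRefl_wallRefl]
        rfl
      rw [this, hb]
      exact n.lt_succ_self

end AffineAction

/-- the upper set of a dominant element is the complement of the interior of
its star. -/
theorem statement6
    {W : Type*} [Group W] {M : CoxeterMatrix (Fin 3)} (cs : CoxeterSystem M W)
    (hM : ∀ i j : Fin 3, M i j = if i = j then 1 else 3)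
    (act : W →* Equiv.Perm E2)
    (h0 : ∀ v, act (cs.simple 0) v = reflE rho2 (-1) v)
    (h1 : ∀ v, act (cs.simple 1) v = reflE a1 0 v)
    (h2 : ∀ v, act (cs.simple 2) v = reflE a2 0 v)
    (hcen : Function.Injective (cen act))
    (th ths : ℕ → ℕ → W)
    (hth : ∀ m n : ℕ, cen act (th m n) =
      cen act (cs.simple 1 * cs.simple 2 * cs.simple 1) + (m : ℝ) • fw1 + (n : ℝ) • fw2)
    (hths : ∀ m n : ℕ, cen act (ths m n) =
      cen act 1 + ((m : ℝ) + 1) • fw1 + ((n : ℝ) + 1) • fw2)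
    (x : W) (hx : x ∈ Dset th ths) (p q : ℝ)
    (hp : p = B2 fw1 (cen act x)) (hq : q = B2 fw2 (cen act x)) :
    ∀ z : W, bruhatLE cs x z ↔
      cen act z ∉ interior
        (({v : E2 | B2 fw2 v ≤ q ∧ -q - 1 ≤ B2 fw1 v ∧ -q - 1 ≤ B2 (fw2 - fw1) v} : Set E2) ∪
         {v : E2 | B2 fw1 v ≤ p ∧ -p - 1 ≤ B2 fw2 v ∧ B2 (fw2 - fw1) v ≤ p + 1}) := by
  have hact (j : Fin 3) (v : E2) : act (cs.simple j) v = wallRefl j (simpleLevel j) v := by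
    fin_cases j
    · simpa [wallRefl, simpleLevel, posRoot] using h0 v
    · simpa [wallRefl, simpleLevel, posRoot] using h1 v
    · simpa [wallRefl, simpleLevel, posRoot] using h2 v
  obtain ⟨X₀, Y₀, hx₀, hd₀, hn₀⟩ := exists_cen_eq_latPt hact x
  have hp' : p = (2 * X₀ + Y₀) / 3 / 3 := by
    rw [hp, hx₀, B2, fw1, latPt]; ring
  have hq' : q = (X₀ + 2 * Y₀) / 3 / 3 := by
    rw [hq, hx₀, B2, fw2, latPt]; ring
  have hbase : cen act 1 = baseCen := by simp [cen, baseCen]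
  have hlong : cen act (cs.simple 1 * cs.simple 2 * cs.simple 1) = latPt 1 1 := by
    rw [cen, map_mul, map_mul, Equiv.Perm.mul_apply, Equiv.Perm.mul_apply, hact, hact, hact]
    change wallRefl _ _ (wallRefl _ _ (wallRefl _ _ baseCen)) = _
    rw [baseCen_eq, wallRefl_latPt, wallRefl_latPt, wallRefl_latPt]
    simp [reflX, reflY, simpleLevel]
  have hpos : 0 < X₀ ∧ 0 < Y₀ := by
    have hX : (X₀ : ℝ) = 2 * (cen act x).1 * 3 - (cen act x).2 * 3 := by
      rw [hx₀, latPt]; ring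
    have hY : (Y₀ : ℝ) = 2 * (cen act x).2 * 3 - (cen act x).1 * 3 := by
      rw [hx₀, latPt]; ring
    rw [← Int.cast_pos (R := ℝ), ← Int.cast_pos (R := ℝ), hX, hY]
    rcases hx with ⟨m, n, rfl⟩ | ⟨m, n, rfl⟩
    · rw [hth, hlong]
      simp [latPt, fw1, fw2]
      constructor <;> linarith [m.cast_nonneg (α := ℝ), n.cast_nonneg (α := ℝ)]
    · rw [hths, hbase, baseCen_eq]
      simp [latPt, fw1, fw2]
      constructor <;> linarith [m.cast_nonneg (α := ℝ), n.cast_nonneg (α := ℝ)]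
  have hX₀ : (0 : ℝ) < X₀ := Int.cast_pos.2 hpos.1
  have hY₀ : (0 : ℝ) < Y₀ := Int.cast_pos.2 hpos.2
  set S := interior
    (({v : E2 | B2 fw2 v ≤ q ∧ -q - 1 ≤ B2 fw1 v ∧ -q - 1 ≤ B2 (fw2 - fw1) v} : Set E2) ∪
      {v : E2 | B2 fw1 v ≤ p ∧ -p - 1 ≤ B2 fw2 v ∧ B2 (fw2 - fw1) v ≤ p + 1}) with hS
  have hstar (X Y : ℤ) : latPt X Y ∈ S ↔ InStar X₀ Y₀ X Y := by
    rw [hS, mem_interior_star_iff (by rw [hp']; positivity) (by rw [hq']; positivity), InStar, hp',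
      hq', latPt]
    simp only [← Int.cast_lt (R := ℝ)]
    push_cast
    refine or_congr (and_congr ?_ (and_congr ?_ ?_)) (and_congr ?_ (and_congr ?_ ?_)) <;>
      constructor <;> intro h <;> linarith
  have hmul {t : W} {i k} (ht : ∀ v, act t v = wallRefl i k v) {z : W} {X Y : ℤ}
      (hz : cen act z = latPt X Y) :
      cen act (t * z) = latPt (reflX i k X Y) (reflY i k X Y) := by
    rw [← wallRefl_latPt, ← hz, ← ht, cen, cen, map_mul, Equiv.Perm.mul_apply]
  intro z
  constructor
  · have hstep (a b : W) (ht : ∃ t, cs.IsReflection t ∧ b = t * a)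
        (hlen : cs.length a < cs.length b) (ha : cen act a ∉ S) : cen act b ∉ S := by
      obtain ⟨t, ht, rfl⟩ := ht
      obtain ⟨i, k, htv⟩ := exists_wallRefl_of_isReflection hact ht
      obtain ⟨X, Y, hta, -, -⟩ := exists_cen_eq_latPt hact (t * a)
      have hca : cen act a = latPt (reflX i k X Y) (reflY i k X Y) := by
        rw [← hmul htv hta, ← mul_assoc, ht.mul_self, one_mul]
      have hsep : Separates i k X Y := by
        rw [← wallFun_mul_neg_iff, ← hta]
        by_contra hcon
        have h₁ : wallFun i k baseCen ≠ 0 := hbase ▸ wallFun_cen_ne_zero hact i k 1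
        have h₂ := wallFun_cen_ne_zero hact i k (t * a)
        have h₃ : 0 < wallFun i k baseCen * wallFun i k (cen act (t * a)) :=
          lt_of_le_of_ne (not_lt.1 hcon) (mul_ne_zero h₁ h₂).symm
        refine (length_mul_lt_of_separates hcen hact htv (a := a) ?_).not_gt hlen
        rw [hca, ← wallRefl_latPt, ← hta, wallFun_wallRefl]
        linarith
      rw [hta, hstar]
      rw [hca, hstar] at ha
      exact fun h => ha (inStar_of_separates hsep h)
    have hxS : cen act x ∉ S := by
      rw [hx₀, hstar, InStar]
      omega
    rintro (rfl | h)
    · exact hxS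
    · induction h with
      | single h => exact hstep _ _ h.1 h.2 hxS
      | tail _ h ih => exact hstep _ _ h.1 h.2 ih
  · intro hz
    induction hn : cs.length z using Nat.strong_induction_on generalizing z with
    | _ n ih =>
      subst hn
      obtain ⟨X, Y, hzc, hd, hn⟩ := exists_cen_eq_latPt hact z
      by_cases heq : X = X₀ ∧ Y = Y₀
      · obtain ⟨rfl, rfl⟩ := heq
        exact Or.inl (hcen (hx₀.trans hzc.symm))
      · rw [hzc, hstar] at hz
        obtain ⟨i, k, hsep, hout⟩ :=
          exists_separates_not_inStar hpos.1 hpos.2 hd₀ hn₀ hd hn heq hz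
        obtain ⟨t, ht, htv⟩ := exists_isReflection_wallRefl hact i k
        rw [← wallFun_mul_neg_iff, ← hzc] at hsep
        have hlt := length_mul_lt_of_separates hcen hact htv hsep
        have hstep : (∃ t', cs.IsReflection t' ∧ z = t' * (t * z)) ∧
            cs.length (t * z) < cs.length z :=
          ⟨⟨t, ht, by rw [← mul_assoc, ht.mul_self, one_mul]⟩, hlt⟩
        rcases ih _ hlt (t * z) (by rwa [hmul htv hzc, hstar]) rfl with h | h
        · exact Or.inr (h ▸ Relation.TransGen.single hstep)
        · exact Or.inr (h.tail hstep)
end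
end

section
/- Let x, y ∈ D be dominant elements and z ∈ W. (1) If z ≤ y, the interval [z,y] is dihedral and ℓ(z,y) ≥ 4, then cen(z) ∈ Sgm(cen(y), cen(s1 y)) ∪ Sgm(cen(y), cen(s2 y)); conversely, every z ∈ W with cen(z) ∈ Sgm(cen(y), cen(s1 y)) ∪ Sgm(cen(y), cen(s2 y)) satisfies z ≤ y and [z,y] is dihedral. (2) Write cen(x) = pα1 + qα2 and set u1 := (2q+1)α1 + qα2, u3 := (−q−1)α1 + qα2, u2 := pα1 + (2p+1)α2, u6 := pα1 + (−p−1)α2 (four of the six exterior points of the star St(x)). If x ≤ z, the interval [x,z] is dihedral and ℓ(x,z) ≥ 4, then cen(z) ∈ Sgm(u1,u3) ∪ Sgm(u2,u6); conversely, every z ∈ W with x ≤ z and cen(z) ∈ Sgm(u1,u3) ∪ Sgm(u2,u6) satisfies that [x,z] is dihedral. -/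
noncomputable section

open scoped RealInnerProductSpace

/-- An interval `[a, b]` is dihedral if it is isomorphic, as a poset, to a Bruhat interval
of a Coxeter group with two generators. -/
def IsDihedralInterval {B : Type*} {W : Type*} [Group W] {M : CoxeterMatrix B}
    (cs : CoxeterSystem M W) (a b : W) : Prop :=
  ∃ (W' : Type) (instW' : Group W') (M' : CoxeterMatrix (Fin 2))
    (cs' : @CoxeterSystem (Fin 2) M' W' instW') (a' b' : W'),
    ∃ f : {z : W // bruhatLE cs a z ∧ bruhatLE cs z b} ≃
          {z : W' // @bruhatLE (Fin 2) W' instW' M' cs' a' z ∧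
            @bruhatLE (Fin 2) W' instW' M' cs' z b'},
      ∀ u v, bruhatLE cs u.1 v.1 ↔ @bruhatLE (Fin 2) W' instW' M' cs' (f u).1 (f v).1

/-- Combinatorial coordinates of an alcove of type `A₂`: the alcove lies in the strips
`i - 1 < (α₁, v) < i`, `j - 1 < (α₂, v) < j` and `k - 1 < (ρ, v) < k` with `k = i + j - e`. -/
@[ext] structure Alcove where
  i : ℤ
  j : ℤ
  e : ℤ
  he : e = 0 ∨ e = 1

namespace Alcove

/-- The index of the strip in direction `ρ`. -/
def k (u : Alcove) : ℤ := u.i + u.j - u.e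

/-- The number of hyperplanes separating an alcove from the fundamental one. -/
def len (u : Alcove) : ℕ := u.i.natAbs + u.j.natAbs + u.k.natAbs

/-- The invariant of the lines of direction `α₁`. -/
def line1 (u : Alcove) : ℤ := u.i + 2 * u.j - u.e

/-- The invariant of the lines of direction `α₂`. -/
def line2 (u : Alcove) : ℤ := 2 * u.i + u.j - u.e

/-- The invariant of the lines of direction `ρ`. -/
def line0 (u : Alcove) : ℤ := u.i - u.j

/-- Two alcoves are adjacent if they are exchanged by a reflection. -/
def Adj (u v : Alcove) : Prop :=
  u.e + v.e = 1 ∧ (u.line1 = v.line1 ∨ u.line2 = v.line2 ∨ u.line0 = v.line0)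

/-- The edges of the Bruhat graph. -/
def Edge (u v : Alcove) : Prop := Adj u v ∧ u.len < v.len

/-- The strict Bruhat order. -/
def LT (u v : Alcove) : Prop := Relation.TransGen Edge u v

/-- The Bruhat order. -/
def LE (u v : Alcove) : Prop := u = v ∨ LT u v

/-- The fundamental alcove. -/
def base : Alcove := ⟨0, 0, 0, Or.inl rfl⟩

/-- The diagram automorphism exchanging `α₁` and `α₂`. -/
def swap (u : Alcove) : Alcove := ⟨u.j, u.i, u.e, u.he⟩

/-- The action of the simple reflections. -/
def simple (u : Alcove) (a : Fin 3) : Alcove :=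
  match a with
  | 0 => ⟨-u.j, -u.i, 1 - u.e, by have := u.he; omega⟩
  | 1 => ⟨1 - u.i, u.k, 1 - u.e, by have := u.he; omega⟩
  | 2 => ⟨u.k, 1 - u.j, 1 - u.e, by have := u.he; omega⟩

variable {u v w x y z : Alcove}

theorem Adj.symm (h : Adj u v) : Adj v u := by
  simp only [Adj] at *; omega

theorem len_eq_zero_iff : u.len = 0 ↔ u = base := by
  have := u.he
  simp only [Alcove.ext_iff, len, k, base]
  omega

theorem simple_simple (a : Fin 3) (u : Alcove) : (u.simple a).simple a = u := by
  fin_cases a <;> simp [simple, Alcove.ext_iff, k] <;> ring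

theorem adj_simple (a : Fin 3) (u : Alcove) : Adj u (u.simple a) := by
  fin_cases a <;> simp only [simple, Adj, line1, line2, line0, k] <;> omega

theorem len_simple (a : Fin 3) (u : Alcove) :
    (u.simple a).len = u.len + 1 ∨ (u.simple a).len + 1 = u.len := by
  have := u.he
  fin_cases a <;> simp only [simple, len, k] <;> omega

theorem exists_len_simple_lt (h : u ≠ base) : ∃ a, (u.simple a).len + 1 = u.len := by
  have he := u.he
  rcases lt_or_ge 0 u.i with hi | hi
  · exact ⟨1, by simp only [simple, len, k]; omega⟩
  rcases lt_or_ge 0 u.j with hj | hj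
  · exact ⟨2, by simp only [simple, len, k]; omega⟩
  rcases lt_or_ge u.k 0 with hk | hk
  · exact ⟨0, by simp only [simple, len, k] at *; omega⟩
  · refine absurd (Alcove.ext ?_ ?_ ?_) h <;> simp only [base, k] at * <;> omega

theorem Adj.simple (a : Fin 3) (h : Adj u v) : Adj (u.simple a) (v.simple a) := by
  fin_cases a <;> simp only [Alcove.simple, Adj, line1, line2, line0, k] at * <;> omega

/-- Along a line of direction `α₁`, an edge increases `|i|`. -/
theorem len_lt_iff_of_line1 (he : u.e + v.e = 1) (h : u.line1 = v.line1) :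
    u.len < v.len ↔ u.i.natAbs < v.i.natAbs := by
  have := u.he
  simp only [len, k, line1] at *
  omega

theorem len_lt_iff_of_line2 (he : u.e + v.e = 1) (h : u.line2 = v.line2) :
    u.len < v.len ↔ u.j.natAbs < v.j.natAbs := by
  have := u.he
  simp only [len, k, line2] at *
  omega

theorem len_lt_iff_of_line0 (he : u.e + v.e = 1) (h : u.line0 = v.line0) :
    u.len < v.len ↔ u.k.natAbs < v.k.natAbs := by
  have := u.he
  simp only [len, k, line0] at *
  omega

theorem Edge.eq_or_simple (a : Fin 3) (h : Edge u v) :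
    v = u.simple a ∨ Edge (u.simple a) (v.simple a) := by
  obtain ⟨hadj, hlt⟩ := h
  by_cases hv : v = u.simple a
  · exact Or.inl hv
  refine Or.inr ⟨hadj.simple a, ?_⟩
  have hue := u.he
  have he' := (hadj.simple a).1
  obtain ⟨he, hl | hl | hl⟩ := hadj
  · rw [len_lt_iff_of_line1 he hl] at hlt
    fin_cases a
    · rw [len_lt_iff_of_line2 he' (by
        simp only [Alcove.simple, line1, line2] at *; omega)]
      simp only [Alcove.simple, line1, Alcove.ext_iff] at *
      omega
    · rw [len_lt_iff_of_line1 he' (by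
        simp only [Alcove.simple, line1, k] at *; omega)]
      simp only [Alcove.simple, line1, k, Alcove.ext_iff] at *
      omega
    · rw [len_lt_iff_of_line0 he' (by
        simp only [Alcove.simple, line0, line1, k] at *; omega)]
      simp only [Alcove.simple, line1, k, Alcove.ext_iff] at *
      omega
  · rw [len_lt_iff_of_line2 he hl] at hlt
    fin_cases a
    · rw [len_lt_iff_of_line1 he' (by
        simp only [Alcove.simple, line1, line2] at *; omega)]
      simp only [Alcove.simple, line2, Alcove.ext_iff] at *
      omega
    · rw [len_lt_iff_of_line0 he' (by
        simp only [Alcove.simple, line0, line2, k] at *; omega)]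
      simp only [Alcove.simple, line2, k, Alcove.ext_iff] at *
      omega
    · rw [len_lt_iff_of_line2 he' (by
        simp only [Alcove.simple, line2, k] at *; omega)]
      simp only [Alcove.simple, line2, k, Alcove.ext_iff] at *
      omega
  · rw [len_lt_iff_of_line0 he hl] at hlt
    fin_cases a
    · rw [len_lt_iff_of_line0 he' (by
        simp only [Alcove.simple, line0, k] at *; omega)]
      simp only [Alcove.simple, line0, k, Alcove.ext_iff] at *
      omega
    · rw [len_lt_iff_of_line2 he' (by
        simp only [Alcove.simple, line0, line2, k] at *; omega)]
      simp only [Alcove.simple, line0, k, Alcove.ext_iff] at *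
      omega
    · rw [len_lt_iff_of_line1 he' (by
        simp only [Alcove.simple, line0, line1, k] at *; omega)]
      simp only [Alcove.simple, line0, k, Alcove.ext_iff] at *
      omega

theorem LT.len_lt (h : LT u v) : u.len < v.len := by
  induction h with
  | single h => exact h.2
  | tail _ h ih => exact ih.trans h.2

theorem LE.refl (u : Alcove) : LE u u := Or.inl rfl

theorem LE.trans (h : LE u v) (h' : LE v w) : LE u w := by
  rcases h with rfl | h
  · exact h'
  · rcases h' with rfl | h'
    · exact Or.inr h
    · exact Or.inr (Relation.TransGen.trans h h')

theorem LE.trans_lt (h : LE u v) (h' : LT v w) : LT u w := by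
  rcases h with rfl | h
  · exact h'
  · exact Relation.TransGen.trans h h'

theorem LT.trans_le (h : LT u v) (h' : LE v w) : LT u w := by
  rcases h' with rfl | h'
  · exact h
  · exact Relation.TransGen.trans h h'

/-- A form of the lifting property. -/
theorem LT.simple_lt_or_le (a : Fin 3) (h : LT u v) :
    LT (u.simple a) (v.simple a) ∨ LE (u.simple a) v := by
  induction h using Relation.TransGen.head_induction_on with
  | single h =>
    rcases h.eq_or_simple a with h | h
    · exact Or.inr (Or.inl h.symm)
    · exact Or.inl (.single h)
  | head h h' ih =>
    rcases h.eq_or_simple a with rfl | h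
    · exact Or.inr (Or.inr h')
    · rcases ih with ih | ih
      · exact Or.inl (.head h ih)
      · exact Or.inr (Or.inr (LT.trans_le (.single h) ih))

/-- An edge whose length difference is at least `2` is not a cover. -/
theorem Edge.exists_between (h : Edge u v) (hl : u.len + 2 ≤ v.len) :
    ∃ w, LT u w ∧ LT w v := by
  induction hn : v.len generalizing u v with
  | zero => omega
  | succ n ih =>
    obtain ⟨a, ha⟩ := exists_len_simple_lt (u := v)
      (fun h0 => by rw [len_eq_zero_iff.2 h0] at hn; omega)
    have hvv : LT (v.simple a) v := by
      refine .single ⟨?_, by omega⟩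
      exact (adj_simple a v).symm
    rcases h.eq_or_simple a with rfl | h'
    · rcases len_simple a u with h1 | h1 <;> omega
    · rcases len_simple a u with h1 | h1
      · exact ⟨_, .single ⟨adj_simple a u, by omega⟩, LT.trans_le (.single h') (Or.inr hvv)⟩
      · obtain ⟨w, hw1, hw2⟩ := ih h' (by omega) (by omega)
        have huw := hw1.simple_lt_or_le a
        have hwv := hw2.simple_lt_or_le a
        rw [simple_simple] at huw hwv
        rcases huw with huw | huw
        · rcases hwv with hwv | hwv
          · exact ⟨_, huw, hwv⟩
          · exact ⟨_, huw.trans_le hwv, hvv⟩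
        · exact ⟨_, huw.trans_lt hw2, hvv⟩

/-- A cover increases the length by one. -/
theorem LT.edge_of_cover (h : LT u v) (hc : ∀ w, LT u w → ¬ LT w v) :
    Edge u v ∧ v.len = u.len + 1 := by
  have he : Edge u v := by
    cases h with
    | single h => exact h
    | tail h h' => exact absurd (.single h') (hc _ h)
  refine ⟨he, ?_⟩
  by_contra hne
  obtain ⟨w, h1, h2⟩ := he.exists_between (by have := he.2; omega)
  exact hc w h1 h2

end Alcove

/-- The interval `[z, y]` for the relation `r` is isomorphic, via the height function `H`, to an
interval of a dihedral group: two elements are comparable if and only if their heights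
differ, and there are at least two elements of each intermediate height. -/
structure IsCrown {α : Type*} (r : α → α → Prop) (z y : α) (H : α → ℕ) : Prop where
  le : r z y
  le_iff : ∀ u v, r z u → r u y → r z v → r v y → (r u v ↔ u = v ∨ H u < H v)
  bot : H z = 0
  exists_pair : ∀ h, 0 < h → h < H y → ∃ u v, u ≠ v ∧ (r z u ∧ r u y) ∧ (r z v ∧ r v y) ∧
    H u = h ∧ H v = h

namespace Alcove

variable {u v w x y z : Alcove}

theorem Adj.swap (h : Adj u v) : Adj u.swap v.swap := by
  simp only [Adj, Alcove.swap, line0, line1, line2] at *; omega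

theorem len_swap (u : Alcove) : u.swap.len = u.len := by
  simp only [Alcove.swap, len, k]; omega

theorem swap_swap (u : Alcove) : u.swap.swap = u := rfl

theorem LT.swap (h : LT u v) : LT u.swap v.swap :=
  Relation.TransGen.lift (p := Edge) Alcove.swap
    (fun _ _ h => ⟨h.1.swap, by rw [len_swap, len_swap]; exact h.2⟩) _ _ h

theorem LE.swap (h : LE u v) : LE u.swap v.swap := by
  rcases h with rfl | h
  · exact LE.refl _
  · exact Or.inr h.swap

theorem LE.of_swap (h : LE u.swap v.swap) : LE u v := h.swap

theorem ext_of_adj {d a b : Alcove} (ha : Adj a d) (hb : Adj b d) (h1 : a.line1 = b.line1)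
    (h2 : a.line2 = b.line2) : a = b := by
  simp only [Adj, line1, line2, Alcove.ext_iff] at *
  omega

theorem exists_common_adj_mem {d d' : Alcove}
    (hn : ¬(d.line1 = d'.line1 ∨ d.line2 = d'.line2 ∨ d.line0 = d'.line0)) :
    ∃ p q r : ℤ × ℤ, ∀ a, Adj a d → Adj a d' →
      (a.line1, a.line2) = p ∨ (a.line1, a.line2) = q ∨ (a.line1, a.line2) = r := by
  have hd := d.he
  by_cases hm : (d'.line1 - d.line1 - (1 - 2 * d.e)) % 3 = 0
  · refine ⟨(d'.line1, d.line2), (d.line1, d.line1 + (d'.line2 - d'.line1)),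
      (d'.line2 - (d.line2 - d.line1), d'.line2), fun a h h' => ?_⟩
    simp only [Adj, line0, line1, line2, Prod.mk.injEq] at *
    omega
  · refine ⟨(d.line1, d'.line2), (d.line2 - (d'.line2 - d'.line1), d.line2),
      (d'.line1, d'.line1 + (d.line2 - d.line1)), fun a h h' => ?_⟩
    simp only [Adj, line0, line1, line2, Prod.mk.injEq] at *
    omega

/-- Two alcoves of the same parity not on a common line have at most three common neighbours. -/
theorem collinear_of_common_adj {d d' a₁ a₂ a₃ a₄ : Alcove}
    (h₁ : Adj a₁ d) (h₁' : Adj a₁ d') (h₂ : Adj a₂ d) (h₂' : Adj a₂ d')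
    (h₃ : Adj a₃ d) (h₃' : Adj a₃ d') (h₄ : Adj a₄ d) (h₄' : Adj a₄ d')
    (h₁₂ : a₁ ≠ a₂) (h₁₃ : a₁ ≠ a₃) (h₁₄ : a₁ ≠ a₄) (h₂₃ : a₂ ≠ a₃) (h₂₄ : a₂ ≠ a₄)
    (h₃₄ : a₃ ≠ a₄) : d.line1 = d'.line1 ∨ d.line2 = d'.line2 ∨ d.line0 = d'.line0 := by
  by_contra hn
  obtain ⟨p, q, r, hpqr⟩ := exists_common_adj_mem hn
  have key : ∀ {a b}, Adj a d → Adj b d → a ≠ b → (a.line1, a.line2) ≠ (b.line1, b.line2) :=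
    fun ha hb hne h => hne (ext_of_adj ha hb (congrArg Prod.fst h) (congrArg Prod.snd h))
  have k₁₂ := key h₁ h₂ h₁₂
  have k₁₃ := key h₁ h₃ h₁₃
  have k₁₄ := key h₁ h₄ h₁₄
  have k₂₃ := key h₂ h₃ h₂₃
  have k₂₄ := key h₂ h₄ h₂₄
  have k₃₄ := key h₃ h₄ h₃₄
  have m₁ := hpqr _ h₁ h₁'
  have m₂ := hpqr _ h₂ h₂'
  have m₃ := hpqr _ h₃ h₃'
  have m₄ := hpqr _ h₄ h₄'
  grind

theorem line1_eq_of_common_adj {d d' a : Alcove} (h : Adj a d) (h' : Adj a d')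
    (hne : d ≠ d') (hl : d.line1 = d'.line1) : a.line1 = d.line1 := by
  have := d.he
  simp only [Adj, line1, line2, line0, ne_eq, Alcove.ext_iff] at *
  omega

theorem line2_eq_of_common_adj {d d' a : Alcove} (h : Adj a d) (h' : Adj a d')
    (hne : d ≠ d') (hl : d.line2 = d'.line2) : a.line2 = d.line2 := by
  have := d.he
  simp only [Adj, line1, line2, line0, ne_eq, Alcove.ext_iff] at *
  omega

theorem line0_eq_of_common_adj {d d' a : Alcove} (h : Adj a d) (h' : Adj a d')
    (hne : d ≠ d') (hl : d.line0 = d'.line0) : a.line0 = d.line0 := by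
  have := d.he
  simp only [Adj, line1, line2, line0, ne_eq, Alcove.ext_iff] at *
  omega

end Alcove

namespace Alcove

section Crown

variable {u v x y z : Alcove} {H : Alcove → ℕ}

theorem height_le_of_crown (h : IsCrown LE z y H) (hu : LE z u ∧ LE u y) : H u ≤ H y := by
  rcases (h.le_iff u y hu.1 hu.2 h.le (LE.refl y)).1 hu.2 with rfl | hlt
  · exact le_rfl
  · exact hlt.le

theorem edge_of_crown (h : IsCrown LE z y H) (hu : LE z u ∧ LE u y) (hv : LE z v ∧ LE v y)
    (hH : H v = H u + 1) : Edge u v ∧ v.len = u.len + 1 := by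
  have huv : LE u v := (h.le_iff u v hu.1 hu.2 hv.1 hv.2).2 (Or.inr (by omega))
  rcases huv with rfl | huv
  · omega
  refine huv.edge_of_cover fun w huw hwv => ?_
  have hw : LE z w ∧ LE w y := ⟨hu.1.trans (Or.inr huw), LE.trans (Or.inr hwv) hv.2⟩
  have h1 := (h.le_iff u w hu.1 hu.2 hw.1 hw.2).1 (Or.inr huw)
  have h2 := (h.le_iff w v hw.1 hw.2 hv.1 hv.2).1 (Or.inr hwv)
  rcases h1 with rfl | h1
  · exact huw.len_lt.ne rfl
  rcases h2 with rfl | h2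
  · exact hwv.len_lt.ne rfl
  omega

/-- In a crown the height is the length. -/
theorem len_eq_of_crown (h : IsCrown LE z y H) (hu : LE z u ∧ LE u y) :
    u.len = z.len + H u := by
  induction hn : H u generalizing u with
  | zero =>
    rcases (h.le_iff z u (LE.refl z) h.le hu.1 hu.2).1 hu.1 with rfl | h1
    · rfl
    · omega
  | succ n ih =>
    have hy := height_le_of_crown h hu
    have hex : ∃ w, (LE z w ∧ LE w y) ∧ H w = n := by
      rcases Nat.eq_zero_or_pos n with rfl | hpos
      · exact ⟨z, ⟨LE.refl z, h.le⟩, h.bot⟩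
      · obtain ⟨w, -, -, hw, -, hw', -⟩ := h.exists_pair n hpos (by omega)
        exact ⟨w, hw, hw'⟩
    obtain ⟨w, hw, hwn⟩ := hex
    have h1 := ih hw hwn
    have h2 := (edge_of_crown h hw hu (by omega)).2
    omega

/-- There are two elements of each intermediate length in a crown. -/
theorem exists_pair_len (h : IsCrown LE z y H) {n : ℕ} (h1 : z.len < n) (h2 : n < y.len) :
    ∃ u v, u ≠ v ∧ (LE z u ∧ LE u y) ∧ (LE z v ∧ LE v y) ∧ u.len = n ∧ v.len = n := by
  have hy := len_eq_of_crown h ⟨h.le, LE.refl y⟩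
  obtain ⟨u, v, hne, hu, hv, hHu, hHv⟩ := h.exists_pair (n - z.len) (by omega) (by omega)
  have := len_eq_of_crown h hu
  have := len_eq_of_crown h hv
  exact ⟨u, v, hne, hu, hv, by omega, by omega⟩

/-- A crown all of whose low elements lie on a common line lies on this line. -/
theorem line_eq_of_crown (h : IsCrown LE z y H) (hl : z.len + 4 ≤ y.len) (line : Alcove → ℤ)
    (hline : ∀ {d d' a : Alcove}, Adj a d → Adj a d' → d ≠ d' → line d = line d' →
      line a = line d) {d d' : Alcove} (hd : LE z d ∧ LE d y) (hd' : LE z d' ∧ LE d' y)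
    (hne : d ≠ d') (hHd : H d = 2) (hHd' : H d' = 2) (heq : line d = line d')
    (hu : LE z u ∧ LE u y) : line u = line d := by
  have hy := len_eq_of_crown h ⟨h.le, LE.refl y⟩
  have h1 : ∀ u, LE z u ∧ LE u y → H u = 1 → line u = line d := fun u hu hu1 =>
    hline (edge_of_crown h hu hd (by omega)).1.1 (edge_of_crown h hu hd' (by omega)).1.1 hne heq
  induction hn : H u using Nat.strong_induction_on generalizing u with
  | _ n ih =>
    have hle := height_le_of_crown h hu
    rcases Nat.lt_or_ge n 1 with hn0 | hn1
    · obtain ⟨c, c', hcc, hc, hc', hHc, hHc'⟩ := h.exists_pair 1 (by omega) (by omega)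
      rw [hline (edge_of_crown h hu hc (by omega)).1.1 (edge_of_crown h hu hc' (by omega)).1.1
        hcc (by rw [h1 c hc hHc, h1 c' hc' hHc']), h1 c hc hHc]
    · rcases Nat.eq_or_lt_of_le hn1 with rfl | hn2
      · exact h1 u hu hn
      · obtain ⟨c, c', hcc, hc, hc', hHc, hHc'⟩ := h.exists_pair (n - 1) (by omega) (by omega)
        have e1 := ih (n - 1) (by omega) hc hHc
        have e2 := ih (n - 1) (by omega) hc' hHc'
        rw [hline (edge_of_crown h hc hu (by omega)).1.1.symm
          (edge_of_crown h hc' hu (by omega)).1.1.symm hcc (by rw [e1, e2]), e1]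

/-- A crown of length at least `4` lies on a line. -/
theorem exists_line_of_crown (h : IsCrown LE z y H) (hl : z.len + 4 ≤ y.len) :
    (∀ u, LE z u ∧ LE u y → u.line1 = z.line1) ∨ (∀ u, LE z u ∧ LE u y → u.line2 = z.line2) ∨
      (∀ u, LE z u ∧ LE u y → u.line0 = z.line0) := by
  have hy := len_eq_of_crown h ⟨h.le, LE.refl y⟩
  obtain ⟨c, c', hcc, hc, hc', hHc, hHc'⟩ := h.exists_pair 1 (by omega) (by omega)
  obtain ⟨d, d', hdd, hd, hd', hHd, hHd'⟩ := h.exists_pair 2 (by omega) (by omega)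
  obtain ⟨e, e', hee, he, he', hHe, hHe'⟩ := h.exists_pair 3 (by omega) (by omega)
  have hne : ∀ {a b}, H a = 1 → H b = 3 → a ≠ b := by
    rintro a b ha hb rfl
    omega
  have hz : LE z z ∧ LE z y := ⟨LE.refl z, h.le⟩
  have key := collinear_of_common_adj
    (edge_of_crown h hc hd (by omega)).1.1 (edge_of_crown h hc hd' (by omega)).1.1
    (edge_of_crown h hc' hd (by omega)).1.1 (edge_of_crown h hc' hd' (by omega)).1.1
    (edge_of_crown h hd he (by omega)).1.1.symm (edge_of_crown h hd' he (by omega)).1.1.symm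
    (edge_of_crown h hd he' (by omega)).1.1.symm (edge_of_crown h hd' he' (by omega)).1.1.symm
    hcc (hne hHc hHe) (hne hHc hHe') (hne hHc' hHe) (hne hHc' hHe') hee
  rcases key with key | key | key
  · have := fun u => line_eq_of_crown (u := u) h hl line1 line1_eq_of_common_adj hd hd'
      hdd hHd hHd' key
    exact Or.inl fun u hu => (this u hu).trans (this z hz).symm
  · have := fun u => line_eq_of_crown (u := u) h hl line2 line2_eq_of_common_adj hd hd'
      hdd hHd hHd' key
    exact Or.inr (Or.inl fun u hu => (this u hu).trans (this z hz).symm)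
  · have := fun u => line_eq_of_crown (u := u) h hl line0 line0_eq_of_common_adj hd hd'
      hdd hHd hHd' key
    exact Or.inr (Or.inr fun u hu => (this u hu).trans (this z hz).symm)

end Crown

/-! ### Gaps on lines -/

section Gaps

variable {u v c c' d d' x y z : Alcove}

theorem len_lt_of_line0_right (hl : u.line0 = v.line0) (h0 : 0 ≤ u.k) (h : u.k < v.k) :
    u.len < v.len := by
  have := u.he
  have := v.he
  simp only [line0, len, k] at *
  omega

theorem len_lt_of_line0_left (hl : u.line0 = v.line0) (h0 : u.k ≤ 0) (h : v.k < u.k) :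
    u.len < v.len := by
  have := u.he
  have := v.he
  simp only [line0, len, k] at *
  omega

theorem eq_of_line0 (hl : u.line0 = v.line0) (h : u.k = v.k) : u = v := by
  have := u.he
  have := v.he
  simp only [line0, k, Alcove.ext_iff] at *
  omega

theorem exists_right_of_line0 (hl : u.line0 = v.line0) (hne : u ≠ v) (h : u.len = v.len) :
    0 < u.k ∨ 0 < v.k := by
  by_contra! hcon
  rcases lt_trichotomy u.k v.k with h1 | h1 | h1
  · exact (len_lt_of_line0_left hl.symm hcon.2 h1).ne h.symm
  · exact hne (eq_of_line0 hl h1)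
  · exact (len_lt_of_line0_left hl hcon.1 h1).ne h

theorem len_lt_of_line1_right (hB : 0 < u.line1) (hl : u.line1 = v.line1) (h0 : 0 ≤ u.i)
    (h : u.i < v.i) : u.len < v.len := by
  have := u.he
  have := v.he
  simp only [line1, len, k] at *
  omega

theorem len_lt_of_line1_left (hB : 0 < u.line1) (hl : u.line1 = v.line1) (h0 : u.i ≤ 0)
    (h : v.i < u.i) : u.len < v.len := by
  have := u.he
  have := v.he
  simp only [line1, len, k] at *
  omega

theorem eq_of_line1 (hl : u.line1 = v.line1) (h : u.i = v.i) : u = v := by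
  have := u.he
  have := v.he
  simp only [line1, Alcove.ext_iff] at *
  omega

theorem sides_of_line1 (hB : 0 < u.line1) (hl : u.line1 = v.line1) (hne : u ≠ v)
    (h : u.len = v.len) : (0 < u.i ∧ v.i < 0) ∨ (0 < v.i ∧ u.i < 0) := by
  rcases lt_trichotomy u.i v.i with h1 | h1 | h1
  · by_contra! hcon
    rcases le_or_gt 0 u.i with h2 | h2
    · exact (len_lt_of_line1_right hB hl h2 h1).ne h
    · exact (len_lt_of_line1_left (hl ▸ hB) hl.symm
        (by have := hcon.2; by_contra! h3; have := this h3; omega) h1).ne h.symm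
  · exact absurd (eq_of_line1 hl h1) hne
  · by_contra! hcon
    rcases le_or_gt 0 v.i with h2 | h2
    · exact (len_lt_of_line1_right (hl ▸ hB) hl.symm h2 h1).ne h.symm
    · exact (len_lt_of_line1_left hB hl
        (by have := hcon.1; by_contra! h3; have := this h3; omega) h1).ne h

/-- The lengths of the alcoves on a line of direction `ρ` have gaps just below a dominant one. -/
theorem gap_below_of_line0 (hi : 0 < y.i) (hj : 0 < y.j) (hc : c.line0 = y.line0)
    (hd : d.line0 = y.line0) (hck : 0 < c.k) (hdk : 0 < d.k) (hcl : c.len + 1 = y.len)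
    (hdl : d.len + 2 = y.len) : False := by
  have hck' : c.k < y.k := by
    by_contra! hcon
    rcases hcon.eq_or_lt with h | h
    · rw [eq_of_line0 hc h.symm] at hcl; omega
    · have := len_lt_of_line0_right hc.symm (by simp only [k]; have := y.he; omega) h; omega
  have hdk' : d.k < c.k := by
    by_contra! hcon
    rcases hcon.eq_or_lt with h | h
    · rw [eq_of_line0 (hc.trans hd.symm) h] at hcl; omega
    · have := len_lt_of_line0_right (hc.trans hd.symm) hck.le h; omega
  have := y.he
  have := c.he
  have := d.he
  simp only [line0, len, k] at *
  omega

/-- The lengths of the alcoves on a line of direction `ρ` have gaps just above a dominant one. -/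
theorem gap_above_of_line0 (hi : 0 < x.i) (hj : 0 < x.j) (hc : c.line0 = x.line0)
    (hd : d.line0 = x.line0) (hck : 0 < c.k) (hdk : 0 < d.k) (hcl : c.len = x.len + 1)
    (hdl : d.len = x.len + 2) : False := by
  have hck' : x.k < c.k := by
    by_contra! hcon
    rcases hcon.eq_or_lt with h | h
    · rw [eq_of_line0 hc h] at hcl; omega
    · have := len_lt_of_line0_right hc hck.le h; omega
  have hdk' : c.k < d.k := by
    by_contra! hcon
    rcases hcon.eq_or_lt with h | h
    · rw [eq_of_line0 (hd.trans hc.symm) h] at hdl; omega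
    · have := len_lt_of_line0_right (hd.trans hc.symm) hdk.le h; omega
  have := x.he
  have := c.he
  have := d.he
  simp only [line0, len, k] at *
  omega

/-- The lengths of the alcoves on a line of direction `α₁` have gaps beyond the zone
`0 ≤ j, 0 ≤ k`. -/
theorem gap_right_of_line1 (hB : 0 < z.line1) (hj : z.j < 0) (hc : c.line1 = z.line1)
    (hd : d.line1 = z.line1) (hci : 0 < c.i) (hdi : 0 < d.i) (hcl : c.len + 1 = z.len)
    (hdl : d.len + 2 = z.len) : False := by
  have hzi : 0 < z.i := by simp only [line1] at hB; have := z.he; omega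
  have hci' : c.i < z.i := by
    by_contra! hcon
    rcases hcon.eq_or_lt with h | h
    · rw [eq_of_line1 hc h.symm] at hcl; omega
    · have := len_lt_of_line1_right hB hc.symm hzi.le h; omega
  have hdi' : d.i < c.i := by
    by_contra! hcon
    rcases hcon.eq_or_lt with h | h
    · rw [eq_of_line1 (hc.trans hd.symm) h] at hcl; omega
    · have := len_lt_of_line1_right (hc ▸ hB) (hc.trans hd.symm) hci.le h; omega
  have := z.he
  have := c.he
  have := d.he
  simp only [line1, len, k] at *
  omega

theorem gap_left_of_line1 (hB : 0 < z.line1) (hk : z.k < 0) (hc : c.line1 = z.line1)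
    (hd : d.line1 = z.line1) (hci : c.i < 0) (hdi : d.i < 0) (hcl : c.len + 1 = z.len)
    (hdl : d.len + 2 = z.len) : False := by
  have hzi : z.i < 0 := by simp only [line1, k] at hB hk; have := z.he; omega
  have hci' : z.i < c.i := by
    by_contra! hcon
    rcases hcon.eq_or_lt with h | h
    · rw [eq_of_line1 hc h] at hcl; omega
    · have := len_lt_of_line1_left hB hc.symm hzi.le h; omega
  have hdi' : c.i < d.i := by
    by_contra! hcon
    rcases hcon.eq_or_lt with h | h
    · rw [eq_of_line1 (hc.trans hd.symm) h.symm] at hcl; omega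
    · have := len_lt_of_line1_left (hc ▸ hB) (hc.trans hd.symm) hci.le h; omega
  have := z.he
  have := c.he
  have := d.he
  simp only [line1, len, k] at *
  omega

end Gaps

end Alcove

/-- The interval `[z, y]` for the relation `r` is isomorphic, via the function `f`, to an
interval of the infinite dihedral group, whose elements are indexed by `ℤ` and ordered by
their absolute value. -/
structure IsIndexed {α : Type*} (r : α → α → Prop) (z y : α) (f : α → ℤ) : Prop where
  le : r z y
  le_iff : ∀ u v, r z u → r u y → r z v → r v y → (r u v ↔ u = v ∨ (f u).natAbs < (f v).natAbs)
  inj : ∀ u v, r z u → r u y → r z v → r v y → f u = f v → u = v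
  surj : ∀ m, (m = f z ∨ (f z).natAbs < m.natAbs) → (m = f y ∨ m.natAbs < (f y).natAbs) →
    ∃ u, r z u ∧ r u y ∧ f u = m

namespace Alcove

variable {u v c c' d d' x y z : Alcove} {H : Alcove → ℕ}

theorem zone_of_line1 (hB : 0 < z.line1) (hcc : c ≠ c') (hdd : d ≠ d') (hc : c.line1 = z.line1)
    (hc' : c'.line1 = z.line1) (hd : d.line1 = z.line1) (hd' : d'.line1 = z.line1)
    (hcl : c.len + 1 = z.len) (hcl' : c'.len + 1 = z.len) (hdl : d.len + 2 = z.len)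
    (hdl' : d'.len + 2 = z.len) : 0 ≤ z.j ∧ 0 ≤ z.k := by
  have sc := sides_of_line1 (hc ▸ hB) (hc.trans hc'.symm) hcc (by omega)
  have sd := sides_of_line1 (hd ▸ hB) (hd.trans hd'.symm) hdd (by omega)
  constructor <;> by_contra! hcon
  · rcases sc with sc | sc <;> rcases sd with sd | sd
    · exact gap_right_of_line1 hB hcon hc hd sc.1 sd.1 hcl hdl
    · exact gap_right_of_line1 hB hcon hc hd' sc.1 sd.1 hcl hdl'
    · exact gap_right_of_line1 hB hcon hc' hd sc.1 sd.1 hcl' hdl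
    · exact gap_right_of_line1 hB hcon hc' hd' sc.1 sd.1 hcl' hdl'
  · rcases sc with sc | sc <;> rcases sd with sd | sd
    · exact gap_left_of_line1 hB hcon hc' hd' sc.2 sd.2 hcl' hdl'
    · exact gap_left_of_line1 hB hcon hc' hd sc.2 sd.2 hcl' hdl
    · exact gap_left_of_line1 hB hcon hc hd' sc.2 sd.2 hcl hdl'
    · exact gap_left_of_line1 hB hcon hc hd sc.2 sd.2 hcl hdl

/-- Crowns of length at least `4` below a dominant alcove. -/
theorem crown_below (hi : 0 < y.i) (hj : 0 < y.j) (h : IsCrown LE z y H)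
    (hl : z.len + 4 ≤ y.len) :
    (z.line1 = y.line1 ∧ z.i.natAbs < y.i.natAbs) ∨
      (z.line2 = y.line2 ∧ z.j.natAbs < y.j.natAbs) := by
  have hy : LE z y ∧ LE y y := ⟨h.le, LE.refl y⟩
  have hye := y.he
  have hze := z.he
  rcases exists_line_of_crown h hl with hline | hline | hline
  · refine Or.inl ⟨(hline y hy).symm, ?_⟩
    have := hline y hy
    simp only [line1, len, k] at *
    omega
  · refine Or.inr ⟨(hline y hy).symm, ?_⟩
    have := hline y hy
    simp only [line2, len, k] at *
    omega
  · exfalso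
    have hz := hline y hy
    obtain ⟨c, c', hcc, hc, hc', hcl, hcl'⟩ :=
      exists_pair_len h (n := y.len - 1) (by omega) (by omega)
    obtain ⟨d, d', hdd, hd, hd', hdl, hdl'⟩ :=
      exists_pair_len h (n := y.len - 2) (by omega) (by omega)
    have lc := (hline c hc).trans hz.symm
    have lc' := (hline c' hc').trans hz.symm
    have ld := (hline d hd).trans hz.symm
    have ld' := (hline d' hd').trans hz.symm
    rcases exists_right_of_line0 (lc.trans lc'.symm) hcc (by omega) with sc | sc <;>
      rcases exists_right_of_line0 (ld.trans ld'.symm) hdd (by omega) with sd | sd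
    · exact gap_below_of_line0 hi hj lc ld sc sd (by omega) (by omega)
    · exact gap_below_of_line0 hi hj lc ld' sc sd (by omega) (by omega)
    · exact gap_below_of_line0 hi hj lc' ld sc sd (by omega) (by omega)
    · exact gap_below_of_line0 hi hj lc' ld' sc sd (by omega) (by omega)

/-- Crowns of length at least `4` above a dominant alcove. -/
theorem crown_above (hi : 0 < x.i) (hj : 0 < x.j) (h : IsCrown LE x z H)
    (hl : x.len + 4 ≤ z.len) :
    (z.line1 = x.line1 ∧ 0 ≤ z.j ∧ 0 ≤ z.k) ∨ (z.line2 = x.line2 ∧ 0 ≤ z.i ∧ 0 ≤ z.k) := by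
  have hz : LE x z ∧ LE z z := ⟨h.le, LE.refl z⟩
  have hxe := x.he
  obtain ⟨c, c', hcc, hc, hc', hcl, hcl'⟩ :=
    exists_pair_len h (n := z.len - 1) (by omega) (by omega)
  obtain ⟨d, d', hdd, hd, hd', hdl, hdl'⟩ :=
    exists_pair_len h (n := z.len - 2) (by omega) (by omega)
  rcases exists_line_of_crown h hl with hline | hline | hline
  · have lz := hline z hz
    refine Or.inl ⟨lz, zone_of_line1 ?_ hcc hdd ((hline c hc).trans lz.symm)
      ((hline c' hc').trans lz.symm) ((hline d hd).trans lz.symm)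
      ((hline d' hd').trans lz.symm) (by omega) (by omega) (by omega) (by omega)⟩
    rw [lz, line1]
    omega
  · have lz := hline z hz
    have sw : ∀ w : Alcove, w.swap.line1 = w.line2 := fun w => by
      simp only [swap, line1, line2]; omega
    have inj : ∀ {v w : Alcove}, v ≠ w → v.swap ≠ w.swap := fun hne h =>
      hne (congrArg swap h)
    have := zone_of_line1 (z := z.swap) (by rw [sw, lz, line2]; omega) (inj hcc) (inj hdd)
      (by rw [sw, sw, hline c hc, lz]) (by rw [sw, sw, hline c' hc', lz])
      (by rw [sw, sw, hline d hd, lz]) (by rw [sw, sw, hline d' hd', lz])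
      (by rw [len_swap, len_swap]; omega) (by rw [len_swap, len_swap]; omega)
      (by rw [len_swap, len_swap]; omega) (by rw [len_swap, len_swap]; omega)
    refine Or.inr ⟨lz, ?_⟩
    simp only [swap, k] at this ⊢
    omega
  · exfalso
    obtain ⟨c, c', hcc, hc, hc', hcl, hcl'⟩ :=
      exists_pair_len h (n := x.len + 1) (by omega) (by omega)
    obtain ⟨d, d', hdd, hd, hd', hdl, hdl'⟩ :=
      exists_pair_len h (n := x.len + 2) (by omega) (by omega)
    have lc := hline c hc
    have lc' := hline c' hc'
    have ld := hline d hd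
    have ld' := hline d' hd'
    rcases exists_right_of_line0 (lc.trans lc'.symm) hcc (by omega) with sc | sc <;>
      rcases exists_right_of_line0 (ld.trans ld'.symm) hdd (by omega) with sd | sd
    · exact gap_above_of_line0 hi hj lc ld sc sd (by omega) (by omega)
    · exact gap_above_of_line0 hi hj lc ld' sc sd (by omega) (by omega)
    · exact gap_above_of_line0 hi hj lc' ld sc sd (by omega) (by omega)
    · exact gap_above_of_line0 hi hj lc' ld' sc sd (by omega) (by omega)

/-! ### Intervals along a line of direction `α₁` -/

/-- The alcove with given first coordinate on a line of direction `α₁`. -/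
def onLine1 (B i : ℤ) : Alcove :=
  ⟨i, (B - i + (i - B) % 2) / 2, (i - B) % 2, by omega⟩

theorem line1_onLine1 (B i : ℤ) : (onLine1 B i).line1 = B := by
  simp only [onLine1, line1]; omega

theorem edge_of_line1 (hl : u.line1 = v.line1) (he : u.e + v.e = 1)
    (h : u.i.natAbs < v.i.natAbs) : Edge u v :=
  ⟨⟨he, Or.inl hl⟩, (len_lt_iff_of_line1 he hl).2 h⟩

theorem lt_of_line1 (hl : u.line1 = v.line1) (h : u.i.natAbs < v.i.natAbs) : LT u v := by
  have hu := u.he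
  have hv := v.he
  by_cases he : u.e + v.e = 1
  · exact .single (edge_of_line1 hl he h)
  · have hm := line1_onLine1 u.line1 (u.i.natAbs + 1)
    refine .head (b := onLine1 u.line1 (u.i.natAbs + 1)) ?_ (.single ?_) <;>
      refine edge_of_line1 (by omega) ?_ ?_ <;> simp only [onLine1, line1] at * <;> omega

/-- The triangle bounded by an orbit of lines of direction `α₁`, centred at the vertex `0` of the
fundamental alcove, is a lower set. -/
theorem LE.bound_zero {K : ℤ} (h : LE u v)
    (hv : v.line1 ≤ K ∧ -v.line2 + 2 ≤ K ∧ v.line0 + 1 ≤ K) :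
    u.line1 ≤ K ∧ -u.line2 + 2 ≤ K ∧ u.line0 + 1 ≤ K := by
  have key : ∀ {u v : Alcove}, Edge u v → v.line1 ≤ K ∧ -v.line2 + 2 ≤ K ∧ v.line0 + 1 ≤ K →
      u.line1 ≤ K ∧ -u.line2 + 2 ≤ K ∧ u.line0 + 1 ≤ K := by
    rintro u v ⟨⟨he, hl | hl | hl⟩, hlen⟩ hv <;> have hve := v.he
    · rw [len_lt_iff_of_line1 he hl] at hlen
      simp only [line1, line2, line0] at *
      omega
    · rw [len_lt_iff_of_line2 he hl] at hlen
      simp only [line1, line2, line0] at *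
      omega
    · rw [len_lt_iff_of_line0 he hl] at hlen
      simp only [line1, line2, line0, k] at *
      omega
  rcases h with rfl | h
  · exact hv
  induction h using Relation.TransGen.head_induction_on with
  | single h => exact key h hv
  | head h _ ih => exact key h ih

/-- The triangle bounded by an orbit of lines of direction `α₁`, centred at the vertex `-ϖ₂` of the
fundamental alcove, is a lower set. -/
theorem LE.bound_neg_weight {K : ℤ} (h : LE u v)
    (hv : v.line1 + 1 ≤ K ∧ -v.line2 ≤ K ∧ v.line0 - 1 ≤ K) :
    u.line1 + 1 ≤ K ∧ -u.line2 ≤ K ∧ u.line0 - 1 ≤ K := by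
  have key : ∀ {u v : Alcove}, Edge u v → v.line1 + 1 ≤ K ∧ -v.line2 ≤ K ∧ v.line0 - 1 ≤ K →
      u.line1 + 1 ≤ K ∧ -u.line2 ≤ K ∧ u.line0 - 1 ≤ K := by
    rintro u v ⟨⟨he, hl | hl | hl⟩, hlen⟩ hv <;> have hve := v.he
    · rw [len_lt_iff_of_line1 he hl] at hlen
      simp only [line1, line2, line0] at *
      omega
    · rw [len_lt_iff_of_line2 he hl] at hlen
      simp only [line1, line2, line0] at *
      omega
    · rw [len_lt_iff_of_line0 he hl] at hlen
      simp only [line1, line2, line0, k] at *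
      omega
  rcases h with rfl | h
  · exact hv
  induction h using Relation.TransGen.head_induction_on with
  | single h => exact key h hv
  | head h _ ih => exact key h ih

end Alcove

namespace Alcove

variable {u v w x y z : Alcove}

theorem mem_zone_of_line1 (hl : z.line1 = y.line1) (hj : 0 ≤ y.j) (hk : 0 ≤ y.k)
    (hz : LE z w) (hy : LE w y) : w.line1 = y.line1 ∧ 0 ≤ w.j ∧ 0 ≤ w.k := by
  have hwe := w.he
  have hye := y.he
  have h1 := hy.bound_zero (K := y.line1 + 2) (by simp only [line1, line2, line0, k] at *; omega)
  have h2 := hy.bound_neg_weight (K := y.line1 + 1)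
    (by simp only [line1, line2, line0, k] at *; omega)
  have h3 := mt (hz.bound_neg_weight (K := y.line1)) (by omega)
  simp only [line1, line2, line0, k] at *
  omega

theorem len_lt_iff_of_zone (hl : u.line1 = v.line1) (huj : 0 ≤ u.j) (huk : 0 ≤ u.k)
    (hvj : 0 ≤ v.j) (hvk : 0 ≤ v.k) : u.len < v.len ↔ u.i.natAbs < v.i.natAbs := by
  have hu := u.he
  have hv := v.he
  simp only [line1, k, len] at *
  omega

theorem le_iff_of_zone (hl : u.line1 = v.line1) (huj : 0 ≤ u.j) (huk : 0 ≤ u.k)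
    (hvj : 0 ≤ v.j) (hvk : 0 ≤ v.k) : LE u v ↔ u = v ∨ u.i.natAbs < v.i.natAbs :=
  or_congr Iff.rfl
    ⟨fun h => (len_lt_iff_of_zone hl huj huk hvj hvk).1 h.len_lt, lt_of_line1 hl⟩

theorem isIndexed_of_line1 (hl : z.line1 = y.line1) (hj : 0 ≤ y.j) (hk : 0 ≤ y.k)
    (h : LE z y) : IsIndexed LE z y Alcove.i where
  le := h
  le_iff u v hzu huy hzv hvy := by
    obtain ⟨hu, huj, huk⟩ := mem_zone_of_line1 hl hj hk hzu huy
    obtain ⟨hv, hvj, hvk⟩ := mem_zone_of_line1 hl hj hk hzv hvy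
    exact le_iff_of_zone (hu.trans hv.symm) huj huk hvj hvk
  inj u v hzu huy hzv hvy huv :=
    eq_of_line1 ((mem_zone_of_line1 hl hj hk hzu huy).1.trans
      (mem_zone_of_line1 hl hj hk hzv hvy).1.symm) huv
  surj m hz hy := by
    have hB := line1_onLine1 y.line1 m
    refine ⟨onLine1 y.line1 m, ?_, ?_, rfl⟩
    · rcases hz with rfl | hz
      · exact Or.inl (eq_of_line1 (hl.trans hB.symm) rfl)
      · exact Or.inr (lt_of_line1 (hl.trans hB.symm) hz)
    · rcases hy with rfl | hy
      · exact Or.inl (eq_of_line1 hB rfl)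
      · exact Or.inr (lt_of_line1 hB hy)

theorem line1_swap (u : Alcove) : u.swap.line1 = u.line2 := by
  simp only [swap, line1, line2]; omega

theorem swap_k (u : Alcove) : u.swap.k = u.k := by
  simp only [swap, k]; omega

theorem isIndexed_of_line2 (hl : z.line2 = y.line2) (hi : 0 ≤ y.i) (hk : 0 ≤ y.k)
    (h : LE z y) : IsIndexed LE z y Alcove.j := by
  have H := isIndexed_of_line1 (z := z.swap) (y := y.swap)
    (by rw [line1_swap, line1_swap, hl]) hi (by rwa [swap_k]) h.swap
  refine ⟨h, fun u v h1 h2 h3 h4 => ?_, fun u v h1 h2 h3 h4 huv => ?_, fun m h1 h2 => ?_⟩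
  · have := H.le_iff u.swap v.swap h1.swap h2.swap h3.swap h4.swap
    rwa [show LE u.swap v.swap ↔ LE u v from ⟨LE.of_swap, LE.swap⟩,
      (Function.LeftInverse.injective swap_swap).eq_iff] at this
  · exact congrArg swap (H.inj u.swap v.swap h1.swap h2.swap h3.swap h4.swap huv)
  · obtain ⟨u, h3, h4, h5⟩ := H.surj m h1 h2
    exact ⟨u.swap, h3.swap, h4.swap, h5⟩

theorem lt_of_line2 (hl : u.line2 = v.line2) (h : u.j.natAbs < v.j.natAbs) : LT u v :=
  (lt_of_line1 (u := u.swap) (v := v.swap) (by rw [line1_swap, line1_swap, hl]) h).swap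

end Alcove

section Bruhat

variable {B W : Type*} [Group W] {M : CoxeterMatrix B} {cs : CoxeterSystem M W} {u v w : W}

theorem bruhatLT_length (h : bruhatLT cs u v) : cs.length u < cs.length v := by
  induction h with
  | single h => exact h.2
  | tail _ h ih => exact ih.trans h.2

theorem bruhatLE_refl (cs : CoxeterSystem M W) (u : W) : bruhatLE cs u u := Or.inl rfl

theorem bruhatLE_trans (h : bruhatLE cs u v) (h' : bruhatLE cs v w) : bruhatLE cs u w := by
  rcases h with rfl | h
  · exact h'
  rcases h' with rfl | h'
  · exact Or.inr h
  · exact Or.inr (Relation.TransGen.trans h h')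

theorem bruhatLE_antisymm (h : bruhatLE cs u v) (h' : bruhatLE cs v u) : u = v := by
  rcases h with h | h
  · exact h
  rcases h' with h' | h'
  · exact h'.symm
  · exact absurd ((bruhatLT_length h).trans (bruhatLT_length h')) (lt_irrefl _)

/-- There are at least two elements of every length strictly between `0` and the length of `w`. -/
theorem exists_ne_length_eq (cs : CoxeterSystem M W) (w : W) {n : ℕ} (h0 : 0 < n)
    (hn : n < cs.length w) : ∃ u v, u ≠ v ∧ cs.length u = n ∧ cs.length v = n := by
  obtain ⟨ω, hω, rfl⟩ := cs.exists_isReduced w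
  rw [hω.eq] at hn
  match ω, hω, hn with
  | a :: ω, hω, hn =>
    obtain ⟨m, rfl⟩ : ∃ m, n = m + 1 := ⟨n - 1, by omega⟩
    rw [List.length_cons] at hn
    have h1 := (hω.take (m + 1)).eq
    have h2 := ((hω.drop 1).take (m + 1)).eq
    have h3 := (hω.take (m + 2)).eq
    simp only [List.take_succ_cons, List.drop_succ_cons, List.drop_zero, List.length_cons,
      List.length_take] at h1 h2 h3
    refine ⟨cs.wordProd (a :: ω.take m), cs.wordProd (ω.take (m + 1)), fun h => ?_,
      by omega, by omega⟩
    rw [cs.wordProd_cons a (ω.take (m + 1)), ← h, cs.wordProd_cons,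
      cs.simple_mul_simple_cancel_left] at h3
    have := cs.length_wordProd_le (ω.take m)
    rw [List.length_take] at this
    omega

end Bruhat

section Dihedral

variable {W : Type*} [Group W] {M : CoxeterMatrix (Fin 2)} (cs : CoxeterSystem M W)

/-- The elements of a dihedral group, indexed by the integers. -/
def dihedralElt (k : ℤ) : W :=
  (cs.simple 1 * cs.simple 0) ^ (k / 2) * if k % 2 = 0 then 1 else cs.simple 1

theorem dihedralElt_zero : dihedralElt cs 0 = 1 := by simp [dihedralElt]

theorem dihedralElt_even (j : ℤ) :
    dihedralElt cs (2 * j) = (cs.simple 1 * cs.simple 0) ^ j := by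
  simp [dihedralElt]

theorem dihedralElt_odd (j : ℤ) :
    dihedralElt cs (2 * j + 1) = (cs.simple 1 * cs.simple 0) ^ j * cs.simple 1 := by
  rw [dihedralElt, if_neg (by omega), show (2 * j + 1) / 2 = j by omega]

theorem simple_one_mul_zpow (j : ℤ) :
    cs.simple 1 * (cs.simple 1 * cs.simple 0) ^ j =
      (cs.simple 1 * cs.simple 0) ^ (-j) * cs.simple 1 := by
  have h : SemiconjBy (cs.simple 1) (cs.simple 1 * cs.simple 0) (cs.simple 1 * cs.simple 0)⁻¹ := by
    simp [SemiconjBy, mul_assoc]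
  rw [zpow_neg, ← inv_zpow]
  exact (h.zpow_right j).eq

theorem simple_one_mul_dihedralElt (k : ℤ) :
    cs.simple 1 * dihedralElt cs k = dihedralElt cs (1 - k) := by
  obtain ⟨j, rfl | rfl⟩ := Int.even_or_odd' k
  · rw [dihedralElt_even, simple_one_mul_zpow, ← dihedralElt_odd]
    congr 1; ring
  · rw [dihedralElt_odd, ← mul_assoc, simple_one_mul_zpow, cs.simple_mul_simple_cancel_right,
      ← dihedralElt_even]
    congr 1; ring

theorem simple_zero_mul_dihedralElt (k : ℤ) :
    cs.simple 0 * dihedralElt cs k = dihedralElt cs (-1 - k) := by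
  have h : dihedralElt cs (k + 2) = cs.simple 1 * cs.simple 0 * dihedralElt cs k := by
    rw [dihedralElt, dihedralElt, show (k + 2) / 2 = 1 + k / 2 by omega, zpow_one_add,
      Int.add_emod_right, mul_assoc]
  rw [show -1 - k = 1 - (k + 2) by ring, ← simple_one_mul_dihedralElt, h, mul_assoc,
    cs.simple_mul_simple_cancel_left]

theorem dihedralElt_surjective : Function.Surjective (dihedralElt cs) := fun w => by
  induction w using cs.simple_induction_left with
  | one => exact ⟨0, dihedralElt_zero cs⟩
  | mul_simple_left w i h =>
    obtain ⟨k, rfl⟩ := h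
    fin_cases i
    · exact ⟨_, (simple_zero_mul_dihedralElt cs k).symm⟩
    · exact ⟨_, (simple_one_mul_dihedralElt cs k).symm⟩

theorem isReflection_of_length_odd {t : W} (h : cs.length t % 2 = 1) : cs.IsReflection t := by
  obtain ⟨k, rfl⟩ := dihedralElt_surjective cs t
  obtain ⟨j, rfl | rfl⟩ := Int.even_or_odd' k
  · have h1 := cs.lengthParity_eq_ofAdd_length (dihedralElt cs (2 * j))
    rw [dihedralElt_even, map_zpow, map_mul, cs.lengthParity_simple, cs.lengthParity_simple,
      ← ofAdd_add, show (1 + 1 : ZMod 2) = 0 from rfl, ofAdd_zero, one_zpow, ← ofAdd_zero,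
      Multiplicative.ofAdd.apply_eq_iff_eq, eq_comm, ZMod.natCast_eq_zero_iff,
      ← dihedralElt_even] at h1
    omega
  · rw [dihedralElt_odd]
    obtain ⟨m, rfl | rfl⟩ := Int.even_or_odd' j
    · refine ⟨(cs.simple 1 * cs.simple 0) ^ m, 1, ?_⟩
      rw [mul_assoc, ← zpow_neg, simple_one_mul_zpow, ← mul_assoc, ← zpow_add, neg_neg, two_mul]
    · refine ⟨(cs.simple 1 * cs.simple 0) ^ m * cs.simple 1, 0, ?_⟩
      rw [mul_inv_rev, cs.inv_simple, ← zpow_neg, simple_one_mul_zpow, neg_neg]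
      simp only [mul_assoc]
      rw [← mul_assoc (cs.simple 1) (cs.simple 0), ← mul_assoc _ _ (cs.simple 1), ← zpow_one_add,
        ← mul_assoc, ← zpow_add]
      congr 2; ring

variable {cs} {u v : W}

theorem bruhatLT_of_length_odd (h : cs.length u < cs.length v)
    (ho : (cs.length u + cs.length v) % 2 = 1) : bruhatLT cs u v :=
  .single ⟨⟨v * u⁻¹, isReflection_of_length_odd cs
    (by rw [cs.length_mul_mod_two, cs.length_inv]; omega), by simp⟩, h⟩

/-- In a dihedral group, the Bruhat order is the order by length. -/
theorem bruhatLT_iff_length_lt : bruhatLT cs u v ↔ cs.length u < cs.length v := by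
  refine ⟨bruhatLT_length, fun h => ?_⟩
  by_cases ho : (cs.length u + cs.length v) % 2 = 1
  · exact bruhatLT_of_length_odd h ho
  · obtain ⟨w, -, -, hw, -⟩ := exists_ne_length_eq cs v (Nat.succ_pos (cs.length u)) (by omega)
    exact (bruhatLT_of_length_odd (v := w) (by omega) (by omega)).trans
      (bruhatLT_of_length_odd (by omega) (by omega))

theorem bruhatLE_iff_length_lt : bruhatLE cs u v ↔ u = v ∨ cs.length u < cs.length v :=
  or_congr Iff.rfl bruhatLT_iff_length_lt

end Dihedral

section Interval

variable {B W : Type*} [Group W] {M : CoxeterMatrix B} {cs : CoxeterSystem M W} {z y : W}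

theorem IsDihedralInterval.exists_isCrown (h : IsDihedralInterval cs z y) (hzy : bruhatLE cs z y) :
    ∃ H : W → ℕ, IsCrown (bruhatLE cs) z y H := by
  classical
  obtain ⟨W', instW', M', cs', a, b, f, hf⟩ := h
  have hzz := bruhatLE_refl cs z
  have hyy := bruhatLE_refl cs y
  have hab : bruhatLE cs' a b := bruhatLE_trans (f ⟨z, hzz, hzy⟩).2.1 (f ⟨z, hzz, hzy⟩).2.2
  have haa := bruhatLE_refl cs' a
  have hbb := bruhatLE_refl cs' b
  have hfz : (f ⟨z, hzz, hzy⟩).1 = a := by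
    refine bruhatLE_antisymm ?_ (f ⟨z, hzz, hzy⟩).2.1
    have := (hf ⟨z, hzz, hzy⟩ (f.symm ⟨a, haa, hab⟩)).1 (f.symm ⟨a, haa, hab⟩).2.1
    rwa [f.apply_symm_apply] at this
  have hfy : (f ⟨y, hzy, hyy⟩).1 = b := by
    refine bruhatLE_antisymm (f ⟨y, hzy, hyy⟩).2.2 ?_
    have := (hf (f.symm ⟨b, hab, hbb⟩) ⟨y, hzy, hyy⟩).1 (f.symm ⟨b, hab, hbb⟩).2.2
    rwa [f.apply_symm_apply] at this
  have hle : ∀ {u v : W'}, bruhatLE cs' u v → cs'.length u ≤ cs'.length v := fun h =>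
    h.elim (fun h => h ▸ le_rfl) fun h => (bruhatLT_length h).le
  refine ⟨fun u => if h : bruhatLE cs z u ∧ bruhatLE cs u y then
    cs'.length (f ⟨u, h⟩).1 - cs'.length a else 0, hzy, fun u v hzu huy hzv hvy => ?_, ?_,
    fun n h0 hn => ?_⟩
  · have hu := hle (f ⟨u, hzu, huy⟩).2.1
    have hv := hle (f ⟨v, hzv, hvy⟩).2.1
    rw [dif_pos ⟨hzu, huy⟩, dif_pos ⟨hzv, hvy⟩, hf ⟨u, hzu, huy⟩ ⟨v, hzv, hvy⟩,
      bruhatLE_iff_length_lt, ← Subtype.ext_iff, f.apply_eq_iff_eq, Subtype.mk_eq_mk]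
    exact or_congr Iff.rfl (by omega)
  · rw [dif_pos ⟨hzz, hzy⟩, hfz, Nat.sub_self]
  · rw [dif_pos ⟨hzy, hyy⟩, hfy] at hn
    obtain ⟨c, d, hcd, hc, hd⟩ := exists_ne_length_eq cs' b (n := cs'.length a + n) (by omega)
      (by omega)
    have hmem : ∀ {c : W'}, cs'.length c = cs'.length a + n → bruhatLE cs' a c ∧ bruhatLE cs' c b :=
      fun hc => ⟨bruhatLE_iff_length_lt.2 (Or.inr (by omega)),
        bruhatLE_iff_length_lt.2 (Or.inr (by omega))⟩
    refine ⟨(f.symm ⟨c, hmem hc⟩).1, (f.symm ⟨d, hmem hd⟩).1, fun h => hcd ?_,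
      (f.symm ⟨c, hmem hc⟩).2, (f.symm ⟨d, hmem hd⟩).2, ?_, ?_⟩
    · simpa using f.symm.injective (Subtype.ext h)
    · rw [dif_pos (f.symm ⟨c, hmem hc⟩).2, Subtype.coe_eta, f.apply_symm_apply]
      change cs'.length c - _ = _
      omega
    · rw [dif_pos (f.symm ⟨d, hmem hd⟩).2, Subtype.coe_eta, f.apply_symm_apply]
      change cs'.length d - _ = _
      omega

end Interval

/-- The Coxeter matrix of the infinite dihedral group. -/
def infiniteDihedralMatrix : CoxeterMatrix (Fin 2) where
  M := !![1, 0; 0, 1]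
  off_diagonal i i' h := by fin_cases i <;> fin_cases i' <;> simp_all

namespace InfiniteDihedral

variable {W : Type*} [Group W] (cs : CoxeterSystem infiniteDihedralMatrix W)

theorem isLiftable_subLeft : infiniteDihedralMatrix.IsLiftable
    ![Equiv.subLeft (-1 : ℤ), Equiv.subLeft 1] := fun i j => by
  fin_cases i <;> fin_cases j <;> ext k <;> simp [infiniteDihedralMatrix]

/-- The action of the infinite dihedral group on the integers. -/
def toPerm : W →* Equiv.Perm ℤ := cs.lift ⟨_, isLiftable_subLeft⟩

theorem toPerm_simple_zero (k : ℤ) : toPerm cs (cs.simple 0) k = -1 - k := by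
  rw [toPerm, cs.lift_apply_simple]; rfl

theorem toPerm_simple_one (k : ℤ) : toPerm cs (cs.simple 1) k = 1 - k := by
  rw [toPerm, cs.lift_apply_simple]; rfl

theorem toPerm_dihedralElt (k : ℤ) : toPerm cs (dihedralElt cs k) 0 = k := by
  have h : toPerm cs (cs.simple 1 * cs.simple 0) = Equiv.addRight 2 := by
    ext k
    rw [map_mul, Equiv.Perm.mul_apply, toPerm_simple_zero, toPerm_simple_one, Equiv.coe_addRight]
    ring
  obtain ⟨j, rfl | rfl⟩ := Int.even_or_odd' k
  · rw [dihedralElt_even, map_zpow, h]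
    simp [mul_comm]
  · rw [dihedralElt_odd, map_mul, map_zpow, h, Equiv.Perm.mul_apply, toPerm_simple_one]
    simp
    ring

theorem length_dihedralElt (k : ℤ) : cs.length (dihedralElt cs k) = k.natAbs := by
  refine le_antisymm ?_ ?_
  · generalize hn : k.natAbs = n
    induction n generalizing k with
    | zero => rw [Int.natAbs_eq_zero.1 hn, dihedralElt_zero, cs.length_one]
    | succ n ih =>
      rcases lt_or_ge 0 k with h | h
      · have h1 := ih (1 - k) (by omega)
        rw [← simple_one_mul_dihedralElt] at h1
        have h2 := cs.length_simple_mul (dihedralElt cs k) 1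
        omega
      · have h1 := ih (-1 - k) (by omega)
        rw [← simple_zero_mul_dihedralElt] at h1
        have h2 := cs.length_simple_mul (dihedralElt cs k) 0
        omega
  · obtain ⟨ω, hω, h⟩ := cs.exists_isReduced (dihedralElt cs k)
    have key : ∀ ω : List (Fin 2), (toPerm cs (cs.wordProd ω) 0).natAbs ≤ ω.length := fun ω => by
      induction ω with
      | nil => simp
      | cons i ω ih =>
        rw [cs.wordProd_cons, map_mul, Equiv.Perm.mul_apply, List.length_cons]
        match i with
        | 0 => rw [toPerm_simple_zero]; omega
        | 1 => rw [toPerm_simple_one]; omega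
    rw [h, hω.eq]
    exact (congrArg Int.natAbs (toPerm_dihedralElt cs k)).symm.le.trans (h ▸ key ω)

theorem dihedralElt_injective : Function.Injective (dihedralElt cs) :=
  Function.LeftInverse.injective (g := fun w => toPerm cs w 0) (toPerm_dihedralElt cs)

theorem bruhatLE_dihedralElt {m n : ℤ} :
    bruhatLE cs (dihedralElt cs m) (dihedralElt cs n) ↔ m = n ∨ m.natAbs < n.natAbs := by
  rw [bruhatLE_iff_length_lt, (dihedralElt_injective cs).eq_iff, length_dihedralElt,
    length_dihedralElt]

end InfiniteDihedral

open InfiniteDihedral in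
theorem IsIndexed.isDihedralInterval {B W : Type*} [Group W] {M : CoxeterMatrix B}
    {cs : CoxeterSystem M W} {z y : W} {f : W → ℤ} (h : IsIndexed (bruhatLE cs) z y f) :
    IsDihedralInterval cs z y := by
  let cs' := infiniteDihedralMatrix.toCoxeterSystem
  have hzz := bruhatLE_refl cs z
  have hyy := bruhatLE_refl cs y
  have hiff : ∀ u v, bruhatLE cs z u → bruhatLE cs u y → bruhatLE cs z v → bruhatLE cs v y →
      (bruhatLE cs u v ↔ bruhatLE cs' (dihedralElt cs' (f u)) (dihedralElt cs' (f v))) := by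
    intro u v h1 h2 h3 h4
    rw [h.le_iff u v h1 h2 h3 h4, bruhatLE_dihedralElt]
    exact or_congr ⟨fun h => h ▸ rfl, h.inj u v h1 h2 h3 h4⟩ Iff.rfl
  let F : {u : W // bruhatLE cs z u ∧ bruhatLE cs u y} →
      {w // bruhatLE cs' (dihedralElt cs' (f z)) w ∧ bruhatLE cs' w (dihedralElt cs' (f y))} :=
    fun u => ⟨dihedralElt cs' (f u.1), (hiff z u hzz h.le u.2.1 u.2.2).1 u.2.1,
      (hiff u y u.2.1 u.2.2 h.le hyy).1 u.2.2⟩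
  have hF : Function.Bijective F := by
    refine ⟨fun u v huv => ?_, fun w => ?_⟩
    · exact Subtype.ext (h.inj u v u.2.1 u.2.2 v.2.1 v.2.2
        (dihedralElt_injective cs' (Subtype.ext_iff.1 huv)))
    · obtain ⟨w, hw1, hw2⟩ := w
      obtain ⟨m, rfl⟩ := dihedralElt_surjective cs' w
      obtain ⟨u, h1, h2, rfl⟩ := h.surj m
        (((bruhatLE_dihedralElt cs').1 hw1).imp_left Eq.symm) ((bruhatLE_dihedralElt cs').1 hw2)
      exact ⟨⟨u, h1, h2⟩, rfl⟩
  exact ⟨_, _, _, cs', _, _, Equiv.ofBijective F hF, fun u v =>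
    hiff u v u.2.1 u.2.2 v.2.1 v.2.2⟩
namespace Alcove

/-- The barycenter of an alcove. -/
def pt (u : Alcove) : E2 := ((2 * u.i + u.j - 1 - u.e) / 3, (u.i + 2 * u.j - 1 - u.e) / 3)

theorem pt_injective : Function.Injective pt := fun u v h => by
  have hu := u.he
  have hv := v.he
  have h1 : (2 * u.i + u.j - 1 - u.e : ℝ) = 2 * v.i + v.j - 1 - v.e := by
    linarith [congrArg Prod.fst h, show u.pt.1 = (2 * u.i + u.j - 1 - u.e) / 3 from rfl,
      show v.pt.1 = (2 * v.i + v.j - 1 - v.e) / 3 from rfl]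
  have h2 : (u.i + 2 * u.j - 1 - u.e : ℝ) = v.i + 2 * v.j - 1 - v.e := by
    linarith [congrArg Prod.snd h, show u.pt.2 = (u.i + 2 * u.j - 1 - u.e) / 3 from rfl,
      show v.pt.2 = (v.i + 2 * v.j - 1 - v.e) / 3 from rfl]
  norm_cast at h1 h2
  rw [Alcove.ext_iff]
  omega

theorem reflE_zero_pt (u : Alcove) : reflE rho2 (-1) u.pt = (u.simple 0).pt := by
  ext <;> simp [reflE, rho2, B2, pt, simple] <;> ring

theorem reflE_one_pt (u : Alcove) : reflE a1 0 u.pt = (u.simple 1).pt := by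
  ext <;> simp [reflE, a1, B2, pt, simple, k] <;> ring

theorem reflE_two_pt (u : Alcove) : reflE a2 0 u.pt = (u.simple 2).pt := by
  ext <;> simp [reflE, a2, B2, pt, simple, k] <;> ring

end Alcove

section Action

variable {W : Type*} [Group W] {M : CoxeterMatrix (Fin 3)} (cs : CoxeterSystem M W)

/-- The bijection between the affine Weyl group and the set of alcoves. -/
theorem exists_equiv_alcove (act : W →* Equiv.Perm E2)
    (h0 : ∀ v, act (cs.simple 0) v = reflE rho2 (-1) v)
    (h1 : ∀ v, act (cs.simple 1) v = reflE a1 0 v)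
    (h2 : ∀ v, act (cs.simple 2) v = reflE a2 0 v)
    (hcen : Function.Injective (cen act)) :
    ∃ Ψ : W ≃ Alcove, (∀ z, cen act z = (Ψ z).pt) ∧ Ψ 1 = .base ∧
      ∀ a z, Ψ (cs.simple a * z) = (Ψ z).simple a := by
  have hs : ∀ a z (u : Alcove), cen act z = u.pt → cen act (cs.simple a * z) = (u.simple a).pt := by
    intro a z u h
    have : cen act (cs.simple a * z) = act (cs.simple a) u.pt := by
      rw [cen, map_mul, Equiv.Perm.mul_apply, ← h, cen]
    rw [this]
    match a with
    | 0 => rw [h0, u.reflE_zero_pt]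
    | 1 => rw [h1, u.reflE_one_pt]
    | 2 => rw [h2, u.reflE_two_pt]
  have hb : cen act 1 = Alcove.base.pt := by
    ext <;> simp [cen, Alcove.pt, Alcove.base, rho2] <;> norm_num
  have hex : ∀ z, ∃ u : Alcove, cen act z = u.pt := fun z => by
    induction z using cs.simple_induction_left with
    | one => exact ⟨_, hb⟩
    | mul_simple_left z a h =>
      obtain ⟨u, hu⟩ := h
      exact ⟨_, hs a z u hu⟩
  choose f hf using hex
  have hf1 : f 1 = .base := Alcove.pt_injective ((hf 1).symm.trans hb)
  have hfs : ∀ a z, f (cs.simple a * z) = (f z).simple a := fun a z =>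
    Alcove.pt_injective ((hf _).symm.trans (hs a z _ (hf z)))
  have hbij : Function.Bijective f := by
    refine ⟨fun z w h => hcen (by rw [hf, hf, h]), fun u => ?_⟩
    generalize hn : u.len = n
    induction n generalizing u with
    | zero => exact ⟨1, hf1.trans (Alcove.len_eq_zero_iff.1 hn).symm⟩
    | succ n ih =>
      obtain ⟨a, ha⟩ := Alcove.exists_len_simple_lt
        (mt Alcove.len_eq_zero_iff.2 (by omega : u.len ≠ 0))
      obtain ⟨z, hz⟩ := ih (u.simple a) (by omega)
      exact ⟨cs.simple a * z, by rw [hfs, hz, Alcove.simple_simple]⟩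
  exact ⟨.ofBijective f hbij, hf, hf1, hfs⟩

variable {cs} {Ψ : W ≃ Alcove} {H : W → ℕ} {u v z y : W}

theorem length_eq_len (h1 : Ψ 1 = .base) (hs : ∀ a z, Ψ (cs.simple a * z) = (Ψ z).simple a)
    (z : W) : cs.length z = (Ψ z).len := by
  refine le_antisymm ?_ ?_
  · generalize hn : (Ψ z).len = n
    induction n generalizing z with
    | zero =>
      rw [Alcove.len_eq_zero_iff, ← h1, Ψ.apply_eq_iff_eq] at hn
      rw [hn, cs.length_one]
    | succ n ih =>
      obtain ⟨a, ha⟩ := Alcove.exists_len_simple_lt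
        (mt Alcove.len_eq_zero_iff.2 (by omega : (Ψ z).len ≠ 0))
      have := ih (cs.simple a * z) (by rw [hs]; omega)
      have := cs.length_simple_mul z a
      omega
  · obtain ⟨ω, hω, rfl⟩ := cs.exists_isReduced z
    rw [hω.eq]
    clear hω
    induction ω with
    | nil => rw [cs.wordProd_nil, h1, Alcove.len_eq_zero_iff.2 rfl]; exact Nat.zero_le _
    | cons a ω ih =>
      rw [cs.wordProd_cons, hs, List.length_cons]
      have := Alcove.len_simple a (Ψ (cs.wordProd ω))
      omega

theorem adj_of_isReflection (hs : ∀ a z, Ψ (cs.simple a * z) = (Ψ z).simple a) {t : W}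
    (ht : cs.IsReflection t) (u : W) : Alcove.Adj (Ψ u) (Ψ (t * u)) := by
  have hmul : ∀ w u v, Alcove.Adj (Ψ u) (Ψ v) → Alcove.Adj (Ψ (w * u)) (Ψ (w * v)) := by
    intro w u v h
    induction w using cs.simple_induction_left with
    | one => simpa using h
    | mul_simple_left w a ih =>
      rw [mul_assoc, mul_assoc, hs, hs]
      exact ih.simple a
  obtain ⟨w, a, rfl⟩ := ht
  have := hmul w (w⁻¹ * u) (cs.simple a * (w⁻¹ * u)) (by rw [hs]; exact Alcove.adj_simple a _)
  simpa [mul_assoc] using this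

theorem exists_isReflection_of_edge (hs : ∀ a z, Ψ (cs.simple a * z) = (Ψ z).simple a)
    (h : Alcove.Edge (Ψ u) (Ψ v)) : ∃ t, cs.IsReflection t ∧ v = t * u := by
  generalize hn : (Ψ v).len = n
  induction n generalizing u v with
  | zero => exact absurd h.2 (by omega)
  | succ n ih =>
    obtain ⟨a, ha⟩ := Alcove.exists_len_simple_lt
      (mt Alcove.len_eq_zero_iff.2 (by omega : (Ψ v).len ≠ 0))
    rcases h.eq_or_simple a with h | h
    · rw [← hs, Ψ.apply_eq_iff_eq] at h
      exact ⟨_, cs.isReflection_simple a, h⟩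
    · rw [← hs, ← hs] at h
      obtain ⟨t, ht, htv⟩ := ih h (by rw [hs]; omega)
      refine ⟨_, ht.conj (cs.simple a), ?_⟩
      rw [mul_assoc, mul_assoc, cs.inv_simple, ← htv, cs.simple_mul_simple_cancel_left]

theorem bruhatLT_iff_lt (h1 : Ψ 1 = .base) (hs : ∀ a z, Ψ (cs.simple a * z) = (Ψ z).simple a) :
    bruhatLT cs u v ↔ Alcove.LT (Ψ u) (Ψ v) := by
  constructor
  · refine Relation.TransGen.lift Ψ ?_ _ _
    rintro a b ⟨⟨t, ht, rfl⟩, hl⟩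
    rw [length_eq_len h1 hs, length_eq_len h1 hs] at hl
    exact ⟨adj_of_isReflection hs ht a, hl⟩
  · intro h
    have := Relation.TransGen.lift (p := fun a b => (∃ t, cs.IsReflection t ∧ b = t * a) ∧
      cs.length a < cs.length b) Ψ.symm (fun a b hab => ?_) _ _ h
    · simpa [Function.onFun, bruhatLT] using this
    · rw [← Ψ.apply_symm_apply a, ← Ψ.apply_symm_apply b] at hab
      exact ⟨exists_isReflection_of_edge hs hab, by
        rw [length_eq_len h1 hs, length_eq_len h1 hs]; exact hab.2⟩

theorem bruhatLE_iff_le (h1 : Ψ 1 = .base) (hs : ∀ a z, Ψ (cs.simple a * z) = (Ψ z).simple a) :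
    bruhatLE cs u v ↔ Alcove.LE (Ψ u) (Ψ v) :=
  or_congr Ψ.apply_eq_iff_eq.symm (bruhatLT_iff_lt h1 hs)

theorem isCrown_symm_comp (h1 : Ψ 1 = .base) (hs : ∀ a z, Ψ (cs.simple a * z) = (Ψ z).simple a)
    (h : IsCrown (bruhatLE cs) z y H) : IsCrown Alcove.LE (Ψ z) (Ψ y) (H ∘ Ψ.symm) := by
  have hle : ∀ {u v}, bruhatLE cs u v ↔ Alcove.LE (Ψ u) (Ψ v) := bruhatLE_iff_le h1 hs
  refine ⟨hle.1 h.le, fun u v => ?_, ?_, fun n h0 hn => ?_⟩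
  · obtain ⟨u, rfl⟩ := Ψ.surjective u
    obtain ⟨v, rfl⟩ := Ψ.surjective v
    simpa [hle] using h.le_iff u v
  · simpa using h.bot
  · obtain ⟨u, v, huv, hu, hv, hun, hvn⟩ := h.exists_pair n h0 (by simpa using hn)
    rw [hle, hle] at hu hv
    exact ⟨Ψ u, Ψ v, Ψ.injective.ne huv, hu, hv, by simpa using hun, by simpa using hvn⟩

theorem isIndexed_comp {f : Alcove → ℤ} (h1 : Ψ 1 = .base)
    (hs : ∀ a z, Ψ (cs.simple a * z) = (Ψ z).simple a)
    (h : IsIndexed Alcove.LE (Ψ z) (Ψ y) f) : IsIndexed (bruhatLE cs) z y (f ∘ Ψ) := by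
  have hle : ∀ {u v}, bruhatLE cs u v ↔ Alcove.LE (Ψ u) (Ψ v) := bruhatLE_iff_le h1 hs
  refine ⟨hle.2 h.le, fun u v => ?_, fun u v => ?_, fun m hz hy => ?_⟩
  · simpa [hle] using h.le_iff (Ψ u) (Ψ v)
  · simpa [hle] using h.inj (Ψ u) (Ψ v)
  · obtain ⟨u, hu⟩ := h.surj m hz hy
    obtain ⟨u, rfl⟩ := Ψ.surjective u
    exact ⟨u, by simpa [hle] using hu⟩

end Action

namespace Alcove

variable {u x y z : Alcove}

theorem pt_eq (u : Alcove) : u.pt = (((u.line2 - 1 : ℤ) : ℝ) / 3, ((u.line1 - 1 : ℤ) : ℝ) / 3) := by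
  ext <;> simp [pt, line1, line2] <;> ring

theorem mem_segment_horizontal {A B C : ℤ} (h : A ≤ B) :
    u.pt ∈ segment ℝ ((B / 3, C / 3) : E2) (A / 3, C / 3) ↔
      u.line1 - 1 = C ∧ A ≤ u.line2 - 1 ∧ u.line2 - 1 ≤ B := by
  have hc : ∀ m n : ℤ, (m / 3 : ℝ) ≤ n / 3 ↔ m ≤ n := fun m n => by
    rw [div_le_div_iff_of_pos_right (by norm_num), Int.cast_le]
  have he : ∀ m n : ℤ, (m / 3 : ℝ) = n / 3 ↔ m = n := fun m n => by
    rw [div_left_inj' (by norm_num), Int.cast_inj]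
  rw [segment_symm, ← Prod.image_mk_segment_left, segment_eq_Icc ((hc A B).2 h), pt_eq]
  simp only [Set.mem_image, Set.mem_Icc, Prod.mk.injEq]
  constructor
  · rintro ⟨r, hr, rfl, h⟩
    exact ⟨((he _ _).1 h).symm, (hc _ _).1 hr.1, (hc _ _).1 hr.2⟩
  · rintro ⟨rfl, h⟩
    exact ⟨_, ⟨(hc _ _).2 h.1, (hc _ _).2 h.2⟩, rfl, rfl⟩

theorem mem_segment_vertical {A B C : ℤ} (h : A ≤ B) :
    u.pt ∈ segment ℝ ((C / 3, B / 3) : E2) (C / 3, A / 3) ↔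
      u.line2 - 1 = C ∧ A ≤ u.line1 - 1 ∧ u.line1 - 1 ≤ B := by
  have hc : ∀ m n : ℤ, (m / 3 : ℝ) ≤ n / 3 ↔ m ≤ n := fun m n => by
    rw [div_le_div_iff_of_pos_right (by norm_num), Int.cast_le]
  have he : ∀ m n : ℤ, (m / 3 : ℝ) = n / 3 ↔ m = n := fun m n => by
    rw [div_left_inj' (by norm_num), Int.cast_inj]
  rw [segment_symm, ← Prod.image_mk_segment_right, segment_eq_Icc ((hc A B).2 h), pt_eq]
  simp only [Set.mem_image, Set.mem_Icc, Prod.mk.injEq]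
  constructor
  · rintro ⟨r, hr, h, rfl⟩
    exact ⟨((he _ _).1 h).symm, (hc _ _).1 hr.1, (hc _ _).1 hr.2⟩
  · rintro ⟨rfl, h⟩
    exact ⟨_, ⟨(hc _ _).2 h.1, (hc _ _).2 h.2⟩, rfl, rfl⟩

/-- The alcoves whose barycenters lie between those of a dominant alcove and its image under
`s₁`. -/
theorem pt_mem_segment_simple_one (hi : 0 < y.i) :
    u.pt ∈ segment ℝ y.pt (y.simple 1).pt ↔
      u.line1 = y.line1 ∧ (u = y ∨ u.i.natAbs < y.i.natAbs) := by
  have hu := u.he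
  have hy := y.he
  have h : (y.simple 1).line1 = y.line1 := by simp only [simple, line1, k]; omega
  rw [pt_eq y, pt_eq (y.simple 1), h, mem_segment_horizontal (by
    simp only [simple, line2, k]; omega), Alcove.ext_iff]
  simp only [simple, line1, line2, k]
  omega

theorem pt_mem_segment_simple_two (hj : 0 < y.j) :
    u.pt ∈ segment ℝ y.pt (y.simple 2).pt ↔
      u.line2 = y.line2 ∧ (u = y ∨ u.j.natAbs < y.j.natAbs) := by
  have hu := u.he
  have hy := y.he
  have h : (y.simple 2).line2 = y.line2 := by simp only [simple, line2, k]; omega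
  rw [pt_eq y, pt_eq (y.simple 2), h, mem_segment_vertical (by
    simp only [simple, line1, k]; omega), Alcove.ext_iff]
  simp only [simple, line1, line2, k]
  omega

/-- The alcoves on the horizontal line through a dominant alcove whose barycenters lie in the
star. -/
theorem pt_mem_segment_star_horizontal (hi : 0 < x.i) (hj : 0 < x.j) :
    u.pt ∈ segment ℝ ((2 * x.pt.2 + 1) • a1 + x.pt.2 • a2) ((-x.pt.2 - 1) • a1 + x.pt.2 • a2) ↔
      u.line1 = x.line1 ∧ 0 ≤ u.j ∧ 0 ≤ u.k := by
  have hu := u.he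
  have hx := x.he
  have h1 : (2 * x.pt.2 + 1) • a1 + x.pt.2 • a2 =
      (((2 * x.line1 + 1 : ℤ) : ℝ) / 3, ((x.line1 - 1 : ℤ) : ℝ) / 3) := by
    rw [pt_eq]; ext <;> simp [a1, a2]; ring
  have h2 : (-x.pt.2 - 1) • a1 + x.pt.2 • a2 =
      (((-x.line1 - 2 : ℤ) : ℝ) / 3, ((x.line1 - 1 : ℤ) : ℝ) / 3) := by
    rw [pt_eq]; ext <;> simp [a1, a2]; ring
  rw [h1, h2, mem_segment_horizontal (by simp only [line1]; omega)]
  simp only [line1, line2, k]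
  omega

theorem pt_mem_segment_star_vertical (hi : 0 < x.i) (hj : 0 < x.j) :
    u.pt ∈ segment ℝ (x.pt.1 • a1 + (2 * x.pt.1 + 1) • a2) (x.pt.1 • a1 + (-x.pt.1 - 1) • a2) ↔
      u.line2 = x.line2 ∧ 0 ≤ u.i ∧ 0 ≤ u.k := by
  have hu := u.he
  have hx := x.he
  have h1 : x.pt.1 • a1 + (2 * x.pt.1 + 1) • a2 =
      (((x.line2 - 1 : ℤ) : ℝ) / 3, ((2 * x.line2 + 1 : ℤ) : ℝ) / 3) := by
    rw [pt_eq]; ext <;> simp [a1, a2]; ring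
  have h2 : x.pt.1 • a1 + (-x.pt.1 - 1) • a2 =
      (((x.line2 - 1 : ℤ) : ℝ) / 3, ((-x.line2 - 2 : ℤ) : ℝ) / 3) := by
    rw [pt_eq]; ext <;> simp [a1, a2]; ring
  rw [h1, h2, mem_segment_vertical (by simp only [line2]; omega)]
  simp only [line1, line2, k]
  omega

end Alcove

theorem B2_fw1 (v : E2) : B2 fw1 v = v.1 := by simp only [B2, fw1]; ring

theorem B2_fw2 (v : E2) : B2 fw2 v = v.2 := by simp only [B2, fw2]; ring

theorem dominant_of_mem_Dset {W : Type*} [Group W] {M : CoxeterMatrix (Fin 3)}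
    {cs : CoxeterSystem M W} {act : W →* Equiv.Perm E2} {th ths : ℕ → ℕ → W}
    (hth : ∀ m n : ℕ, cen act (th m n) =
      cen act (cs.simple 1 * cs.simple 2 * cs.simple 1) + (m : ℝ) • fw1 + (n : ℝ) • fw2)
    (hths : ∀ m n : ℕ, cen act (ths m n) =
      cen act 1 + ((m : ℝ) + 1) • fw1 + ((n : ℝ) + 1) • fw2)
    {Ψ : W ≃ Alcove} (hΨ : ∀ z, cen act z = (Ψ z).pt) (h1 : Ψ 1 = .base)
    (hs : ∀ a z, Ψ (cs.simple a * z) = (Ψ z).simple a) {x : W} (hx : x ∈ Dset th ths) :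
    0 < (Ψ x).i ∧ 0 < (Ψ x).j := by
  have hw : Ψ (cs.simple 1 * cs.simple 2 * cs.simple 1) = ⟨1, 1, 1, Or.inr rfl⟩ := by
    rw [← mul_one (_ * _), mul_assoc, mul_assoc, hs, hs, hs, h1]
    simp [Alcove.simple, Alcove.base, Alcove.k]
  rcases hx with ⟨m, n, rfl⟩ | ⟨m, n, rfl⟩
  · have h : Ψ (th m n) = ⟨m + 1, n + 1, 1, Or.inr rfl⟩ := Alcove.pt_injective <| by
      rw [← hΨ, hth, hΨ, hw]
      ext <;> simp [Alcove.pt, fw1, fw2] <;> ring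
    rw [h]
    exact ⟨by positivity, by positivity⟩
  · have h : Ψ (ths m n) = ⟨m + 1, n + 1, 0, Or.inl rfl⟩ := Alcove.pt_injective <| by
      rw [← hΨ, hths, hΨ, h1]
      ext <;> simp [Alcove.pt, Alcove.base, fw1, fw2] <;> ring
    rw [h]
    exact ⟨by positivity, by positivity⟩

/-- geometric description of dihedral subintervals `[z, y]` and `[x, z]`
for dominant `x, y`. -/
theorem statement7
    {W : Type*} [Group W] {M : CoxeterMatrix (Fin 3)} (cs : CoxeterSystem M W)
    (hM : ∀ i j : Fin 3, M i j = if i = j then 1 else 3)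
    (act : W →* Equiv.Perm E2)
    (h0 : ∀ v, act (cs.simple 0) v = reflE rho2 (-1) v)
    (h1 : ∀ v, act (cs.simple 1) v = reflE a1 0 v)
    (h2 : ∀ v, act (cs.simple 2) v = reflE a2 0 v)
    (hcen : Function.Injective (cen act))
    (th ths : ℕ → ℕ → W)
    (hth : ∀ m n : ℕ, cen act (th m n) =
      cen act (cs.simple 1 * cs.simple 2 * cs.simple 1) + (m : ℝ) • fw1 + (n : ℝ) • fw2)
    (hths : ∀ m n : ℕ, cen act (ths m n) =
      cen act 1 + ((m : ℝ) + 1) • fw1 + ((n : ℝ) + 1) • fw2)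
    (x y : W) (hx : x ∈ Dset th ths) (hy : y ∈ Dset th ths)
    (p q : ℝ) (hp : p = B2 fw1 (cen act x)) (hq : q = B2 fw2 (cen act x))
    (u1 u2 u3 u6 : E2)
    (hu1 : u1 = (2*q + 1) • a1 + q • a2) (hu3 : u3 = (-q - 1) • a1 + q • a2)
    (hu2 : u2 = p • a1 + (2*p + 1) • a2) (hu6 : u6 = p • a1 + (-p - 1) • a2) :
    ((∀ z : W, bruhatLE cs z y → IsDihedralInterval cs z y →
        cs.length z + 4 ≤ cs.length y →
        cen act z ∈ segment ℝ (cen act y) (cen act (cs.simple 1 * y)) ∪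
          segment ℝ (cen act y) (cen act (cs.simple 2 * y))) ∧
      (∀ z : W,
        cen act z ∈ segment ℝ (cen act y) (cen act (cs.simple 1 * y)) ∪
          segment ℝ (cen act y) (cen act (cs.simple 2 * y)) →
        bruhatLE cs z y ∧ IsDihedralInterval cs z y)) ∧
    ((∀ z : W, bruhatLE cs x z → IsDihedralInterval cs x z →
        cs.length x + 4 ≤ cs.length z →
        cen act z ∈ segment ℝ u1 u3 ∪ segment ℝ u2 u6) ∧
      (∀ z : W, bruhatLE cs x z → cen act z ∈ segment ℝ u1 u3 ∪ segment ℝ u2 u6 →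
        IsDihedralInterval cs x z)) := by
  obtain ⟨Ψ, hΨ, hΨ1, hΨs⟩ := exists_equiv_alcove cs act h0 h1 h2 hcen
  obtain ⟨hxi, hxj⟩ := dominant_of_mem_Dset hth hths hΨ hΨ1 hΨs hx
  obtain ⟨hyi, hyj⟩ := dominant_of_mem_Dset hth hths hΨ hΨ1 hΨs hy
  have hle : ∀ {u v}, bruhatLE cs u v ↔ Alcove.LE (Ψ u) (Ψ v) := bruhatLE_iff_le hΨ1 hΨs
  have hyk : 0 ≤ (Ψ y).k := by
    have := (Ψ y).he
    simp only [Alcove.k]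
    omega
  rw [B2_fw1, hΨ] at hp
  rw [B2_fw2, hΨ] at hq
  subst hp hq hu1 hu2 hu3 hu6
  simp only [Set.mem_union, hΨ, hΨs, length_eq_len hΨ1 hΨs,
    Alcove.pt_mem_segment_simple_one hyi, Alcove.pt_mem_segment_simple_two hyj,
    Alcove.pt_mem_segment_star_horizontal hxi hxj, Alcove.pt_mem_segment_star_vertical hxi hxj]
  refine ⟨⟨fun z hz hd hl => ?_, ?_⟩, fun z hz hd hl => ?_, ?_⟩
  · obtain ⟨H, hH⟩ := hd.exists_isCrown hz
    exact (Alcove.crown_below hyi hyj (isCrown_symm_comp hΨ1 hΨs hH) hl).imp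
      (And.imp_right Or.inr) (And.imp_right Or.inr)
  · rintro z (⟨hl, h⟩ | ⟨hl, h⟩)
    · have hzy := h.imp_right (Alcove.lt_of_line1 hl)
      exact ⟨hle.2 hzy, (isIndexed_comp hΨ1 hΨs
        (Alcove.isIndexed_of_line1 hl hyj.le hyk hzy)).isDihedralInterval⟩
    · have hzy := h.imp_right (Alcove.lt_of_line2 hl)
      exact ⟨hle.2 hzy, (isIndexed_comp hΨ1 hΨs
        (Alcove.isIndexed_of_line2 hl hyi.le hyk hzy)).isDihedralInterval⟩
  · obtain ⟨H, hH⟩ := hd.exists_isCrown hz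
    exact Alcove.crown_above hxi hxj (isCrown_symm_comp hΨ1 hΨs hH) hl
  · rintro z hz (⟨hl, h⟩ | ⟨hl, h⟩)
    · exact (isIndexed_comp hΨ1 hΨs
        (Alcove.isIndexed_of_line1 hl.symm h.1 h.2 (hle.1 hz))).isDihedralInterval
    · exact (isIndexed_comp hΨ1 hΨs
        (Alcove.isIndexed_of_line2 hl.symm h.1 h.2 (hle.1 hz))).isDihedralInterval
end
end
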